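/- arXiv:1904.01267 — 2 statements merged into one kernel-verified Lean document; each statement's English description precedes it below -/
import Mathlib

section
/- A two-dimensional uniformly recurrent configuration c over a finite alphabet that has low complexity with respect to a rectangle D = {1,…,n} × {1,…,m} is periodic. -/
/-- Translation of a configuration by `t`: `(Translate t c) n = c (n - t)`. -/
def Translate {A : Type*} (t : ℤ × ℤ) (c : ℤ × ℤ → A) : ℤ × ℤ → A :=
  fun n => c (n - t)

/-- The orbit of a configuration: the set of all its translates. -/
def orbit {A : Type*} (c : ℤ × ℤ → A) : Set (ℤ × ℤ → A) :=
  { d | ∃ t : ℤ × ℤ, d = Translate t c }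

/-- The orbit closure: the topological closure of the orbit (in the product
topology of the discrete topology on the alphabet). -/
def orbitClosure {A : Type*} [TopologicalSpace A] (c : ℤ × ℤ → A) : Set (ℤ × ℤ → A) :=
  closure (orbit c)

/-- The standard inner product on `ℤ²`. -/
def inner2 (x u : ℤ × ℤ) : ℤ := x.1 * u.1 + x.2 * u.2

/-- The discrete half plane in direction `u`. -/
def halfPlane (u : ℤ × ℤ) : Set (ℤ × ℤ) := { x | inner2 x u < 0 }

/-- A set of configurations is deterministic in direction `u`: the contents of a
configuration on the half plane `H_u` determine the whole configuration. -/
def DeterministicIn {A : Type*} (X : Set (ℤ × ℤ → A)) (u : ℤ × ℤ) : Prop :=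
  ∀ d ∈ X, ∀ e ∈ X, Set.EqOn d e (halfPlane u) → d = e

/-- The set of `D`-patterns appearing in `c` : restrictions of translates of `c` to `D`. -/
def patterns {A : Type*} (c : ℤ × ℤ → A) (D : Set (ℤ × ℤ)) : Set (D → A) :=
  { p | ∃ t : ℤ × ℤ, ∀ x : D, p x = Translate t c x }

/-- A configuration is periodic if it is fixed by some non-trivial translation. -/
def Periodic {A : Type*} (c : ℤ × ℤ → A) : Prop :=
  ∃ t : ℤ × ℤ, t ≠ 0 ∧ Translate t c = c

/-- The discrete rectangle `{1,…,n} × {1,…,m}`. -/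
def rect (n m : ℕ) : Set (ℤ × ℤ) :=
  { x | 1 ≤ x.1 ∧ x.1 ≤ (n : ℤ) ∧ 1 ≤ x.2 ∧ x.2 ≤ (m : ℤ) }

/-- Uniform recurrence: every element of the orbit closure generates the same
orbit closure. -/
def UniformlyRecurrent {A : Type*} [TopologicalSpace A] (c : ℤ × ℤ → A) : Prop :=
  ∀ c' ∈ orbitClosure c, orbitClosure c' = orbitClosure c

namespace LowComplexity

open Filter Topology

/-- The iterated difference operator along the vectors of a list. -/
def diffs : List (ℤ × ℤ) → (ℤ × ℤ → ℤ) → (ℤ × ℤ → ℤ)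
  | [], e => e
  | t :: T, e => diffs T (fun n => e (n + t) - e n)

section Annihilators

/-- Laurent polynomials in two variables with integer coefficients. -/
abbrev Laurent := AddMonoidAlgebra ℤ (ℤ × ℤ)

/-- The monomial `X ^ t` acts by translation. -/
def shiftHom : Multiplicative (ℤ × ℤ) →* Module.End ℤ (ℤ × ℤ → ℤ) where
  toFun t :=
    { toFun := fun z n => z (n + t.toAdd)
      map_add' := fun _ _ => rfl
      map_smul' := fun _ _ => rfl }
  map_one' := by ext z n; simp
  map_mul' s t := by
    ext z n
    simp [Module.End.mul_apply, add_comm, add_left_comm]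

/-- The action of Laurent polynomials on integer configurations. -/
noncomputable def act : Laurent →ₐ[ℤ] Module.End ℤ (ℤ × ℤ → ℤ) :=
  AddMonoidAlgebra.lift ℤ _ (ℤ × ℤ) shiftHom

lemma act_single (t : ℤ × ℤ) (a : ℤ) (z : ℤ × ℤ → ℤ) (n : ℤ × ℤ) :
    act (AddMonoidAlgebra.single t a) z n = a * z (n + t) := by
  simp [act, AddMonoidAlgebra.lift_single, shiftHom]

/-- The Laurent polynomial `∑ g d X ^ (q d)`. -/
noncomputable def dilate (s : Finset (ℤ × ℤ)) (g : ℤ × ℤ → ℤ) (q : ℕ) : Laurent :=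
  ∑ d ∈ s, AddMonoidAlgebra.single (q • d) (g d)

lemma act_dilate (s : Finset (ℤ × ℤ)) (g : ℤ × ℤ → ℤ) (q : ℕ) (z : ℤ × ℤ → ℤ) (n : ℤ × ℤ) :
    act (dilate s g q) z n = ∑ d ∈ s, g d * z (n + q • d) := by
  simp only [dilate, map_sum, LinearMap.sum_apply, Finset.sum_apply, act_single]

lemma exists_sum_pow_prime_eq {R ι : Type*} [CommRing R] (p : ℕ) (hp : p.Prime)
    (s : Finset ι) (a : ι → R) :
    ∃ r, (∑ i ∈ s, a i) ^ p = ∑ i ∈ s, a i ^ p + p * r := by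
  classical
  induction s using Finset.induction_on with
  | empty => exact ⟨0, by simp [hp.ne_zero]⟩
  | insert i s hi ih =>
    obtain ⟨r, hr⟩ := ih
    obtain ⟨r', hr'⟩ := exists_add_pow_prime_eq hp (a i) (∑ i ∈ s, a i)
    rw [Finset.sum_insert hi, Finset.sum_insert hi, hr', hr]
    exact ⟨r + a i * (∑ i ∈ s, a i) * r', by ring⟩

lemma exists_dilate_pow_prime (s : Finset (ℤ × ℤ)) (g : ℤ × ℤ → ℤ) (q p : ℕ) (hp : p.Prime) :
    ∃ r, dilate s g (p * q) = dilate s g q ^ p + (p : Laurent) * r := by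
  have : Fact p.Prime := ⟨hp⟩
  obtain ⟨r, hr⟩ := exists_sum_pow_prime_eq p hp s
    (fun d => (AddMonoidAlgebra.single (q • d) (g d) : Laurent))
  have hfermat : ∀ d, ∃ k : ℤ, g d = g d ^ p + p * k := by
    intro d
    have : ((p : ℤ)) ∣ g d - g d ^ p := by
      rw [← ZMod.intCast_zmod_eq_zero_iff_dvd]
      push_cast
      rw [ZMod.pow_card, sub_self]
    obtain ⟨k, hk⟩ := this
    exact ⟨k, by linarith⟩
  choose k hk using hfermat
  refine ⟨(∑ d ∈ s, AddMonoidAlgebra.single ((p * q) • d) (k d)) - r, ?_⟩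
  rw [mul_sub, Finset.mul_sum]
  have h1 : dilate s g q ^ p =
      ∑ d ∈ s, AddMonoidAlgebra.single (q • d) (g d) ^ p + (p : Laurent) * r := hr
  rw [h1, dilate]
  have : ∀ d, (AddMonoidAlgebra.single ((p * q) • d) (g d) : Laurent) =
      AddMonoidAlgebra.single (q • d) (g d) ^ p +
        (p : Laurent) * AddMonoidAlgebra.single ((p * q) • d) (k d) := by
    intro d
    rw [AddMonoidAlgebra.single_pow, smul_smul, ← nsmul_eq_mul, AddMonoidAlgebra.smul_single,
      ← AddMonoidAlgebra.single_add]
    congr 1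
    rw [nsmul_eq_mul]
    exact hk d
  rw [Finset.sum_congr rfl (fun d _ => this d), Finset.sum_add_distrib]
  ring

lemma act_dilate_prime_mul {s : Finset (ℤ × ℤ)} {g z : ℤ × ℤ → ℤ} {M : ℤ}
    (hz : ∀ n, |z n| ≤ M) {q p : ℕ} (hp : p.Prime) (hpM : (∑ d ∈ s, |g d|) * M < p)
    (h : act (dilate s g q) z = 0) : act (dilate s g (p * q)) z = 0 := by
  obtain ⟨r, hr⟩ := exists_dilate_pow_prime s g q p hp
  ext n
  obtain ⟨p', rfl⟩ : ∃ p', p = p' + 1 := ⟨p - 1, by have := hp.one_lt; omega⟩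
  have h1 : act (dilate s g ((p' + 1) * q)) z n = ((p' + 1 : ℕ) : ℤ) * act r z n := by
    rw [hr, map_add, map_mul, map_pow, pow_succ, LinearMap.add_apply, Module.End.mul_apply, h,
      map_zero, zero_add, map_natCast, Module.End.mul_apply, Module.End.natCast_apply,
      Pi.smul_apply, nsmul_eq_mul]
  refine Int.eq_zero_of_abs_lt_dvd (m := ((p' + 1 : ℕ) : ℤ)) ⟨_, h1⟩ ?_
  refine lt_of_le_of_lt ?_ hpM
  rw [act_dilate, Finset.sum_mul]
  refine (Finset.abs_sum_le_sum_abs _ _).trans (Finset.sum_le_sum fun d _ => ?_)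
  rw [abs_mul]
  exact mul_le_mul_of_nonneg_left (hz _) (abs_nonneg _)

lemma act_dilate_of_coprime {s : Finset (ℤ × ℤ)} {g z : ℤ × ℤ → ℤ} {M : ℤ}
    (hz : ∀ n, |z n| ≤ M) (h : act (dilate s g 1) z = 0) (q : ℕ) (hq0 : q ≠ 0)
    (hq : ∀ p, p.Prime → p ∣ q → (∑ d ∈ s, |g d|) * M < p) :
    act (dilate s g q) z = 0 := by
  induction q using induction_on_primes with
  | zero => exact absurd rfl hq0
  | one => exact h
  | prime_mul p a hp ih =>
    refine act_dilate_prime_mul hz hp (hq p hp (dvd_mul_right p a)) (ih ?_ ?_)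
    · rintro rfl
      simp at hq0
    · exact fun p' hp' hd => hq p' hp' (hd.mul_left p)

lemma act_prod_eq_diffs (T : List (ℤ × ℤ)) (z : ℤ × ℤ → ℤ) :
    act ((T.map fun t => (AddMonoidAlgebra.single t 1 - 1 : Laurent)).prod) z = diffs T z := by
  induction T generalizing z with
  | nil => simp [diffs]
  | cons t T ih =>
    rw [List.map_cons, List.prod_cons, mul_comm, map_mul, Module.End.mul_apply, ih, diffs]
    congr 1
    ext n
    simp [act_single]

lemma sum_coeff_mul_dilate (s : Finset (ℤ × ℤ)) (g : ℤ × ℤ → ℤ) (r : ℕ)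
    (Q : Polynomial Laurent) :
    ∑ i ∈ Finset.range (Q.natDegree + 1), Q.coeff i * dilate s g (1 + i * r) =
      ∑ d ∈ s, AddMonoidAlgebra.single d (g d) *
        Q.eval (AddMonoidAlgebra.single (r • d) 1) := by
  simp only [dilate, Polynomial.eval_eq_sum_range, Finset.mul_sum]
  rw [Finset.sum_comm]
  refine Finset.sum_congr rfl fun d _ => Finset.sum_congr rfl fun i _ => ?_
  rw [AddMonoidAlgebra.single_pow, mul_left_comm, AddMonoidAlgebra.single_mul_single]
  simp [add_smul, mul_smul]

/-- A bounded integer configuration with a non-trivial annihilator is annihilated by a product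
of difference operators depending only on the annihilator and on the bound. -/
lemma exists_diffs_eq_zero {s : Finset (ℤ × ℤ)} {g : ℤ × ℤ → ℤ} (M : ℤ) {d₀ : ℤ × ℤ}
    (hd₀ : d₀ ∈ s) (hg : g d₀ ≠ 0) :
    ∃ T : List (ℤ × ℤ), (∀ t ∈ T, t ≠ 0) ∧ ∀ z : ℤ × ℤ → ℤ, (∀ n, |z n| ≤ M) →
      (∀ n, ∑ d ∈ s, g d * z (n + d) = 0) → diffs T z = 0 := by
  classical
  set B := ((∑ d ∈ s, |g d|) * M).toNat with hB
  set r := B.factorial with hr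
  have hr0 : r ≠ 0 := Nat.factorial_ne_zero B
  refine ⟨(s.erase d₀).toList.map fun d => r • (d₀ - d), ?_, ?_⟩
  · intro t ht
    obtain ⟨d, hd, rfl⟩ := List.mem_map.1 ht
    rw [Finset.mem_toList, Finset.mem_erase] at hd
    exact smul_ne_zero hr0 (sub_ne_zero.2 hd.1.symm)
  intro z hz h
  have h1 : act (dilate s g 1) z = 0 := by
    ext n
    simpa [act_dilate] using h n
  have hq : ∀ i : ℕ, act (dilate s g (1 + i * r)) z = 0 := by
    intro i
    refine act_dilate_of_coprime hz h1 _ (by omega) fun p hp hd => ?_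
    have hBp : B < p := by
      by_contra hcon
      have hpr : p ∣ r := hp.dvd_factorial.2 (not_lt.1 hcon)
      have : p ∣ 1 := (Nat.dvd_add_left (hpr.mul_left i)).1 hd
      exact hp.one_lt.ne' (Nat.dvd_one.1 this)
    have := Int.self_le_toNat ((∑ d ∈ s, |g d|) * M)
    omega
  set Q : Polynomial Laurent := ∏ d ∈ s.erase d₀,
    (Polynomial.X - Polynomial.C (AddMonoidAlgebra.single (r • d) 1)) with hQ
  have hev : ∀ d ∈ s, d ≠ d₀ → Q.eval (AddMonoidAlgebra.single (r • d) 1) = 0 := by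
    intro d hd hne
    rw [hQ, Polynomial.eval_prod]
    exact Finset.prod_eq_zero (Finset.mem_erase.2 ⟨hne, hd⟩) (by simp)
  have hev₀ : Q.eval (AddMonoidAlgebra.single (r • d₀) 1) =
      AddMonoidAlgebra.single (∑ d ∈ s.erase d₀, r • d) 1 *
      (((s.erase d₀).toList.map fun d => r • (d₀ - d)).map
        fun t => (AddMonoidAlgebra.single t 1 - 1 : Laurent)).prod := by
    have hU : ∀ s' : Finset (ℤ × ℤ), (AddMonoidAlgebra.single (∑ d ∈ s', r • d) 1 : Laurent) =
        ∏ d ∈ s', AddMonoidAlgebra.single (r • d) 1 := by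
      intro s'
      induction s' using Finset.induction_on with
      | empty => simp [AddMonoidAlgebra.one_def]
      | insert d s' hd ih =>
        rw [Finset.sum_insert hd, Finset.prod_insert hd, ← ih,
          AddMonoidAlgebra.single_mul_single, one_mul]
    rw [hU, List.map_map, Finset.prod_map_toList, ← Finset.prod_mul_distrib, hQ,
      Polynomial.eval_prod]
    refine Finset.prod_congr rfl fun d _ => ?_
    rw [Function.comp, mul_sub, AddMonoidAlgebra.single_mul_single]
    simp [smul_sub]
  have hsum := sum_coeff_mul_dilate s g r Q
  rw [Finset.sum_eq_single_of_mem d₀ hd₀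
    (fun d hd hne => by rw [hev d hd hne, mul_zero]), hev₀, ← mul_assoc,
    AddMonoidAlgebra.single_mul_single, mul_one] at hsum
  have hact := congrArg (fun f => act f z) hsum
  simp only [map_sum, map_mul, LinearMap.sum_apply, Module.End.mul_apply, hq, map_zero,
    Finset.sum_const_zero, act_prod_eq_diffs] at hact
  ext n
  have := congrFun hact (n - (d₀ + ∑ d ∈ s.erase d₀, r • d))
  rw [act_single, sub_add_cancel] at this
  simpa [hg] using this.symm

end Annihilators

section Differences

lemma exists_add_zsmul_lt (a : ℝ) {b : ℝ} (hb : b ≠ 0) (α : ℝ) : ∃ k : ℤ, a + k * b < α := by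
  rcases lt_or_gt_of_ne hb with hb | hb
  · obtain ⟨k, hk⟩ := exists_int_gt ((α - a) / b)
    refine ⟨k, ?_⟩
    rw [div_lt_iff_of_neg hb] at hk
    linarith
  · obtain ⟨k, hk⟩ := exists_int_lt ((α - a) / b)
    refine ⟨k, ?_⟩
    rw [lt_div_iff₀ hb] at hk
    linarith

lemma eq_zero_of_periodic_of_halfPlane (h : ℤ × ℤ →+ ℝ) {t : ℤ × ℤ} (ht : h t ≠ 0)
    {e : ℤ × ℤ → ℤ} (hper : Function.Periodic e t) {α : ℝ} (hα : ∀ n, h n < α → e n = 0) :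
    e = 0 := by
  ext n
  obtain ⟨k, hk⟩ := exists_add_zsmul_lt (h n) ht α
  rw [Pi.zero_apply, ← hper.zsmul k n]
  apply hα
  rw [map_add, map_zsmul, zsmul_eq_mul]
  exact hk

lemma diff_halfPlane (h : ℤ × ℤ →+ ℝ) (t : ℤ × ℤ) {e : ℤ × ℤ → ℤ} {α : ℝ}
    (hα : ∀ n, h n < α → e n = 0) (n : ℤ × ℤ) (hn : h n < α - |h t|) : e (n + t) - e n = 0 := by
  have h1 := le_abs_self (h t)
  have h2 := abs_nonneg (h t)
  rw [hα n (by linarith), hα (n + t) (by rw [map_add]; linarith), sub_zero]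

/-- A configuration vanishing on a half plane and annihilated by differences transversal to the
boundary of the half plane is zero. -/
lemma eq_zero_of_diffs_of_halfPlane (h : ℤ × ℤ →+ ℝ) {T : List (ℤ × ℤ)}
    (hT : ∀ t ∈ T, h t ≠ 0) {e : ℤ × ℤ → ℤ} {α : ℝ} (hα : ∀ n, h n < α → e n = 0)
    (he : diffs T e = 0) : e = 0 := by
  induction T generalizing e α with
  | nil => exact he
  | cons t T ih =>
    have h0 := ih (fun s hs => hT s (List.mem_cons_of_mem _ hs)) (diff_halfPlane h t hα) he
    exact eq_zero_of_periodic_of_halfPlane h (hT t List.mem_cons_self)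
      (fun n => sub_eq_zero.1 (congrFun h0 n)) hα

lemma periodic_of_periodic_diff {e : ℤ × ℤ → ℤ} {M : ℤ} (hM : ∀ n, |e n| ≤ M) {t : ℤ × ℤ}
    (ht : Function.Periodic (fun n => e (n + t) - e n) t) : Function.Periodic e t := by
  intro n
  have hlin : ∀ s : ℕ, e (n + s • t) = e n + s * (e (n + t) - e n) := by
    intro s
    induction s with
    | zero => simp
    | succ s ih =>
      have h1 := ht.nsmul s n
      have h2 : n + (s + 1) • t = n + s • t + t := by rw [succ_nsmul, add_assoc]
      rw [h2]
      push_cast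
      linarith
  by_contra hne
  have h1 : 1 ≤ |e (n + t) - e n| := Int.one_le_abs (sub_ne_zero.2 hne)
  have hM0 : 0 ≤ M := (abs_nonneg _).trans (hM n)
  have h2 := hlin (2 * M + 1).toNat
  have h3 : (((2 * M + 1).toNat : ℕ) : ℤ) = 2 * M + 1 := Int.toNat_of_nonneg (by omega)
  rw [h3] at h2
  have h4 : |(2 * M + 1) * (e (n + t) - e n)| ≤ 2 * M := by
    have : (2 * M + 1) * (e (n + t) - e n) = e (n + (2 * M + 1).toNat • t) - e n := by linarith
    rw [this]
    refine (abs_sub _ _).trans ?_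
    linarith [hM n, hM (n + (2 * M + 1).toNat • t)]
  rw [abs_mul, abs_of_nonneg (by omega : (0 : ℤ) ≤ 2 * M + 1)] at h4
  nlinarith

/-- The second coordinate as a real-valued homomorphism. -/
noncomputable def height : ℤ × ℤ →+ ℝ := (Int.castAddHom ℝ).comp (AddMonoidHom.snd ℤ ℤ)

lemma height_apply (n : ℤ × ℤ) : height n = (n.2 : ℝ) := rfl

/-- Bounded configurations that vanish on a lower half plane and are annihilated by a given
product of differences have a common horizontal period. -/
lemma exists_horizontal_period (T : List (ℤ × ℤ)) (hT : ∀ t ∈ T, t ≠ 0) :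
    ∃ P : ℤ, P ≠ 0 ∧ ∀ (e : ℤ × ℤ → ℤ) (α : ℝ) (M : ℤ), (∀ n, |e n| ≤ M) →
      (∀ n, height n < α → e n = 0) → diffs T e = 0 → Function.Periodic e (P, 0) := by
  induction T with
  | nil =>
    refine ⟨1, one_ne_zero, fun e α M _ _ he => ?_⟩
    have : e = 0 := he
    subst this
    exact fun _ => rfl
  | cons t T ih =>
    obtain ⟨P, hP, hper⟩ := ih fun s hs => hT s (List.mem_cons_of_mem _ hs)
    obtain ⟨k, l⟩ := t
    have hdiff : ∀ (e : ℤ × ℤ → ℤ) (α : ℝ) (M : ℤ), (∀ n, |e n| ≤ M) →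
        (∀ n, height n < α → e n = 0) → diffs ((k, l) :: T) e = 0 →
        Function.Periodic (fun n => e (n + (k, l)) - e n) (P, 0) := by
      intro e α M hM hα he
      refine hper _ (α - |height (k, l)|) (M + M) (fun n => ?_) (diff_halfPlane height (k, l) hα) he
      exact (abs_sub _ _).trans (add_le_add (hM _) (hM _))
    by_cases hl : l = 0
    · subst hl
      have hk : k ≠ 0 := by
        rintro rfl
        exact hT _ List.mem_cons_self rfl
      refine ⟨P * k, mul_ne_zero hP hk, fun e α M hM hα he => ?_⟩
      have h1 := hdiff e α M hM hα he
      refine periodic_of_periodic_diff hM ?_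
      have h2 : ∀ s : ℕ, Function.Periodic (fun n => e (n + s • (k, 0)) - e n) (P, 0) := by
        intro s
        induction s with
        | zero => intro n; simp
        | succ s ihs =>
          intro n
          have h3 := ihs n
          have h4 := h1 (n + s • (k, 0))
          simp only at h3 h4 ⊢
          rw [succ_nsmul, ← add_assoc, ← add_assoc]
          have h5 : n + (P, 0) + s • (k, (0 : ℤ)) = n + s • (k, 0) + (P, 0) := by abel
          rw [h5] at h3 ⊢
          linarith
      have h3 : ∀ s : ℤ, Function.Periodic (fun n => e (n + s • (k, 0)) - e n) (P, 0) := by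
        intro s
        obtain ⟨s, rfl | rfl⟩ := s.eq_nat_or_neg
        · simpa using h2 s
        · intro n
          have h4 := h2 s (n + (-(s : ℤ)) • (k, (0 : ℤ)))
          have h5 : ∀ m : ℤ × ℤ, m + -((s : ℤ)) • (k, (0 : ℤ)) + s • (k, (0 : ℤ)) = m := by
            intro m
            rw [← natCast_zsmul, add_assoc, ← add_smul]
            simp
          have h6 : n + -((s : ℤ)) • (k, (0 : ℤ)) + (P, 0) =
            n + (P, 0) + -((s : ℤ)) • (k, (0 : ℤ)) := by abel
          simp only [h6, h5] at h4 ⊢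
          linarith
      have h4 := (h3 P).zsmul k
      have e1 : P • (k, (0 : ℤ)) = (P * k, 0) := by simp
      have e2 : k • (P, (0 : ℤ)) = (P * k, 0) := by simp [mul_comm]
      rwa [e1, e2] at h4
    · refine ⟨P, hP, fun e α M hM hα he => ?_⟩
      have h1 := hdiff e α M hM hα he
      have h2 : (fun n => e (n + (P, 0)) - e n) = 0 := by
        refine eq_zero_of_periodic_of_halfPlane (t := (k, l)) (α := α - |height (P, 0)|) height
          (by simpa [height_apply] using hl) ?_ (diff_halfPlane height (P, 0) hα)
        intro n
        have := h1 n
        simp only at this ⊢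
        rw [add_right_comm] at this
        linarith
      exact fun n => sub_eq_zero.1 (congrFun h2 n)

end Differences

/-- Non-empty closed translation-invariant sets of configurations. -/
structure IsSubshift {A : Type*} [TopologicalSpace A] (X : Set (ℤ × ℤ → A)) : Prop where
  nonempty : X.Nonempty
  isClosed : IsClosed X
  shift_mem : ∀ x ∈ X, ∀ t : ℤ × ℤ, (fun n => x (n + t)) ∈ X

/-- Subshifts without proper subshifts. -/
structure IsMinimalSubshift {A : Type*} [TopologicalSpace A] (X : Set (ℤ × ℤ → A)) : Prop
    extends IsSubshift X where
  eq_of_subset : ∀ Y ⊆ X, IsSubshift Y → Y = X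

/-- Two points of an infinite set of configurations that differ only far from the origin. -/
lemma exists_min_difference {A : Type*} [Finite A] {X : Set (ℤ × ℤ → A)} (hinf : X.Infinite) (m : ℕ) :
    ∃ x ∈ X, ∃ y ∈ X, ∃ p : ℤ × ℤ, x p ≠ y p ∧ (m : ℤ) < p.1 ^ 2 + p.2 ^ 2 ∧
      ∀ n : ℤ × ℤ, n.1 ^ 2 + n.2 ^ 2 < p.1 ^ 2 + p.2 ^ 2 → x n = y n := by
  classical
  have := hinf.to_subtype
  obtain ⟨⟨x, hx⟩, ⟨y, hy⟩, hne, heq⟩ := Finite.exists_ne_map_eq_of_infinite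
    (fun (x : X) (n : Finset.Icc ((-m, -m) : ℤ × ℤ) (m, m)) => x.1 n.1)
  have hex : ∃ k : ℕ, ∃ p : ℤ × ℤ, x p ≠ y p ∧ p.1 ^ 2 + p.2 ^ 2 = (k : ℤ) := by
    obtain ⟨p, hp⟩ := Function.ne_iff.1 (fun h => hne (Subtype.ext h))
    exact ⟨(p.1 ^ 2 + p.2 ^ 2).toNat, p, hp, (Int.toNat_of_nonneg (by positivity)).symm⟩
  obtain ⟨p, hp, hpk⟩ := Nat.find_spec hex
  refine ⟨x, hx, y, hy, p, hp, ?_, fun n hn => ?_⟩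
  · by_contra hcon
    refine hp (congrFun heq ⟨p, ?_⟩)
    have h1 : p.1 ^ 2 ≤ m := by nlinarith [sq_nonneg p.2]
    have h2 : p.2 ^ 2 ≤ m := by nlinarith [sq_nonneg p.1]
    have h3 : ∀ a : ℤ, a ^ 2 ≤ m → -(m : ℤ) ≤ a ∧ a ≤ m := fun a ha => by
      constructor <;> nlinarith
    rw [Finset.mem_Icc]
    exact ⟨⟨(h3 _ h1).1, (h3 _ h2).1⟩, (h3 _ h1).2, (h3 _ h2).2⟩
  · by_contra hcon
    refine Nat.find_min hex (m := (n.1 ^ 2 + n.2 ^ 2).toNat) ?_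
      ⟨n, hcon, (Int.toNat_of_nonneg (by positivity)).symm⟩
    have : ((n.1 ^ 2 + n.2 ^ 2).toNat : ℤ) = n.1 ^ 2 + n.2 ^ 2 :=
      Int.toNat_of_nonneg (by positivity)
    omega

/-- Every point of a finite subshift is periodic. -/
lemma exists_period_of_finite {A : Type*} [TopologicalSpace A] {X : Set (ℤ × ℤ → A)} (hX : IsSubshift X) (hfin : X.Finite)
    {c : ℤ × ℤ → A} (hc : c ∈ X) : ∃ t : ℤ × ℤ, t ≠ 0 ∧ Function.Periodic c t := by
  have := hfin.to_subtype
  obtain ⟨k, l, hne, heq⟩ := Finite.exists_ne_map_eq_of_infinite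
    (fun k : ℤ => (⟨_, hX.shift_mem c hc (k, 0)⟩ : X))
  refine ⟨(k - l, 0), by simpa [sub_eq_zero] using hne, fun n => ?_⟩
  have := congrFun (congrArg Subtype.val heq) (n - (l, 0))
  have e1 : n - (l, 0) + (k, 0) = n + (k - l, 0) := by
    ext
    · simp only [Prod.fst_add, Prod.fst_sub]
      ring
    · simp
  have e2 : n - (l, 0) + (l, 0) = n := sub_add_cancel _ _
  simpa only [e1, e2] using this

/-- All points of a minimal subshift share the periods of each of its points. -/
lemma IsMinimalSubshift.periodic {A : Type*} [TopologicalSpace A] [T2Space A]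
    {X : Set (ℤ × ℤ → A)} (hX : IsMinimalSubshift X)
    {z : ℤ × ℤ → A} (hz : z ∈ X) {t : ℤ × ℤ} (hper : Function.Periodic z t)
    {c : ℤ × ℤ → A} (hc : c ∈ X) : Function.Periodic c t := by
  have hY : {x | x ∈ X ∧ Function.Periodic x t} = X := by
    refine hX.eq_of_subset _ (fun _ h => h.1) ⟨⟨z, hz, hper⟩, ?_,
      fun x hx s => ⟨hX.shift_mem x hx.1 s, fun n => ?_⟩⟩
    · have : {x : ℤ × ℤ → A | Function.Periodic x t} = ⋂ n, {x | x (n + t) = x n} := by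
        ext x
        simp [Function.Periodic]
      have hcl : IsClosed {x : ℤ × ℤ → A | Function.Periodic x t} := by
        rw [this]
        exact isClosed_iInter fun n => isClosed_eq (continuous_apply _) (continuous_apply _)
      exact hX.isClosed.inter hcl
    · have := hx.2 (n + s)
      simp only
      rw [add_right_comm, this]
  rw [← hY] at hc
  exact hc.2

section Compactness

variable {A : Type*} [Finite A] [TopologicalSpace A] [DiscreteTopology A]

/-- Every sequence in a closed set of configurations converges along the hyperfilter. -/
lemma exists_limit {X : Set (ℤ × ℤ → A)} (hX : IsClosed X) (x : ℕ → ℤ × ℤ → A)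
    (hx : ∀ m, x m ∈ X) :
    ∃ z ∈ X, ∀ n, ∀ᶠ m in (hyperfilter ℕ : Filter ℕ), x m n = z n := by
  obtain ⟨z, hz, hle⟩ := hX.isCompact.ultrafilter_le_nhds ((hyperfilter ℕ).map x)
    (tendsto_principal.2 (Eventually.of_forall hx))
  refine ⟨z, hz, fun n => ?_⟩
  have h1 : Tendsto x (hyperfilter ℕ : Filter ℕ) (𝓝 z) := hle
  have h2 := (tendsto_pi_nhds.1 h1) n
  rw [nhds_discrete, tendsto_pure] at h2
  exact h2

lemma exists_real_limit (a : ℕ → ℝ) (ha : ∀ m, a m ∈ Set.Icc (-1 : ℝ) 1) :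
    ∃ α, Tendsto a (hyperfilter ℕ : Filter ℕ) (𝓝 α) := by
  obtain ⟨α, -, hle⟩ := (isCompact_Icc (a := (-1 : ℝ)) (b := 1)).ultrafilter_le_nhds
    ((hyperfilter ℕ).map a) (tendsto_principal.2 (Eventually.of_forall ha))
  exact ⟨α, hle⟩

lemma eventually_hyperfilter_of_atTop {p : ℕ → Prop} (h : ∀ᶠ m in atTop, p m) :
    ∀ᶠ m in (hyperfilter ℕ : Filter ℕ), p m :=
  h.filter_mono Nat.hyperfilter_le_atTop

/-- The real linear functional with the given coefficients, restricted to the integer lattice. -/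
noncomputable def functional (α β : ℝ) : ℤ × ℤ →+ ℝ where
  toFun n := α * n.1 + β * n.2
  map_zero' := by simp
  map_add' := by intros; simp; ring

/-- An infinite subshift has a direction of non-determinism. -/
lemma exists_nondeterministic {X : Set (ℤ × ℤ → A)} (hX : IsSubshift X) (hinf : X.Infinite) :
    ∃ α β : ℝ, (α ≠ 0 ∨ β ≠ 0) ∧ ∃ x ∈ X, ∃ y ∈ X,
      (∀ n, functional α β n < 0 → x n = y n) ∧ x 0 ≠ y 0 := by
  choose x hx y hy p hp hm hmin using exists_min_difference hinf
  set ρ : ℕ → ℝ := fun m => Real.sqrt ((p m).1 ^ 2 + (p m).2 ^ 2) with hρ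
  have hρsq : ∀ m, ρ m ^ 2 = (p m).1 ^ 2 + (p m).2 ^ 2 := fun m =>
    Real.sq_sqrt (by positivity)
  have hmr : ∀ m : ℕ, (m : ℝ) < (p m).1 ^ 2 + (p m).2 ^ 2 := fun m => by exact_mod_cast hm m
  have hρpos : ∀ m, 0 < ρ m := fun m =>
    Real.sqrt_pos.2 (lt_of_le_of_lt (Nat.cast_nonneg m) (hmr m))
  have hbound : ∀ a b r : ℝ, 0 < r → r ^ 2 = a ^ 2 + b ^ 2 → a / r ∈ Set.Icc (-1 : ℝ) 1 := by
    intro a b r hr h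
    rw [Set.mem_Icc, le_div_iff₀ hr, div_le_iff₀ hr]
    constructor <;> nlinarith [sq_nonneg b]
  obtain ⟨α, hα⟩ := exists_real_limit (fun m => (p m).1 / ρ m)
    fun m => hbound _ _ _ (hρpos m) (hρsq m)
  obtain ⟨β, hβ⟩ := exists_real_limit (fun m => (p m).2 / ρ m)
    fun m => hbound _ (p m).1 _ (hρpos m) (by rw [hρsq, add_comm])
  have hαβ : α ^ 2 + β ^ 2 = 1 := by
    refine tendsto_nhds_unique ((hα.pow 2).add (hβ.pow 2)) ?_
    refine tendsto_const_nhds.congr fun m => ?_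
    have := (hρpos m).ne'
    field_simp
    exact hρsq m
  obtain ⟨x', hx', hxlim⟩ := exists_limit hX.isClosed (fun m n => x m (n + p m))
    fun m => hX.shift_mem _ (hx m) _
  obtain ⟨y', hy', hylim⟩ := exists_limit hX.isClosed (fun m n => y m (n + p m))
    fun m => hX.shift_mem _ (hy m) _
  refine ⟨α, β, ?_, x', hx', y', hy', fun n hn => ?_, ?_⟩
  · by_contra! h
    rw [h.1, h.2] at hαβ
    norm_num at hαβ
  · have hn' : α * n.1 + β * n.2 < 0 := hn
    have h1 : Tendsto (fun m => (p m).1 / ρ m * n.1 + (p m).2 / ρ m * n.2)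
      (hyperfilter ℕ : Filter ℕ) (𝓝 (α * n.1 + β * n.2)) :=
      (hα.mul_const _).add (hβ.mul_const _)
    have h2 := h1.eventually_lt_const
      (show α * n.1 + β * n.2 < (α * n.1 + β * n.2) / 2 by linarith)
    have hρlim : Tendsto ρ atTop atTop := by
      refine tendsto_atTop_mono (fun m => ?_)
        (Real.tendsto_sqrt_atTop.comp tendsto_natCast_atTop_atTop)
      exact Real.sqrt_le_sqrt (hmr m).le
    have h3 := eventually_hyperfilter_of_atTop
      (hρlim.eventually_gt_atTop (((n.1 : ℝ) ^ 2 + n.2 ^ 2) / -(α * n.1 + β * n.2)))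
    obtain ⟨m, ⟨⟨h2, h3⟩, h4⟩, h5⟩ := (((h2.and h3).and (hxlim n)).and (hylim n)).exists
    rw [← h4, ← h5]
    apply hmin
    rw [div_lt_iff₀ (by linarith)] at h3
    have h6 : (p m).1 * (n.1 : ℝ) + (p m).2 * n.2 < ρ m * ((α * n.1 + β * n.2) / 2) := by
      have := mul_lt_mul_of_pos_left h2 (hρpos m)
      have hne := (hρpos m).ne'
      have e : ρ m * ((p m).1 / ρ m * n.1 + (p m).2 / ρ m * n.2) =
        (p m).1 * (n.1 : ℝ) + (p m).2 * n.2 := by field_simp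
      rwa [e] at this
    have h7 : (((n + p m).1 ^ 2 + (n + p m).2 ^ 2 : ℤ) : ℝ) <
        (((p m).1 ^ 2 + (p m).2 ^ 2 : ℤ) : ℝ) := by
      simp only [Prod.fst_add, Prod.snd_add]
      push_cast
      nlinarith
    exact_mod_cast h7
  · obtain ⟨m, h1, h2⟩ := ((hxlim 0).and (hylim 0)).exists
    rw [← h1, ← h2, zero_add]
    exact hp m

end Compactness

section OneSided

/-- The cells of the rows `J + 1, …, J + w` in the columns `0, …, P - 1`. -/
noncomputable def block (P w : ℕ) (J : ℤ) : Finset (ℤ × ℤ) :=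
  Finset.Ico 0 (P : ℤ) ×ˢ Finset.Ioc J (J + w)

lemma mem_block {P w : ℕ} {J : ℤ} {n : ℤ × ℤ} :
    n ∈ block P w J ↔ (0 ≤ n.1 ∧ n.1 < P) ∧ J < n.2 ∧ n.2 ≤ J + w := by
  simp [block]

/-- Families of points of `X` whose pairwise differences, computed through `ν`, have horizontal
period `P`, and which are pairwise distinct on every block of height `w`. -/
def families {A : Type*} (X : Set (ℤ × ℤ → A)) (ν : A → ℤ) (P w N : ℕ) :
    Set (Fin N → ℤ × ℤ → A) :=
  {b | (∀ i, b i ∈ X) ∧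
    (∀ i j, Function.Periodic (fun n => ν (b i n) - ν (b j n)) ((P : ℤ), 0)) ∧
    ∀ i j, i ≠ j → ∀ J : ℤ, ∃ n ∈ block P w J, b i n ≠ b j n}

lemma exists_block_ne {A : Type*} {ν : A → ℤ} (hν : Function.Injective ν) {P w : ℕ} (hP : P ≠ 0)
    {x y : ℤ × ℤ → A} (hper : Function.Periodic (fun n => ν (x n) - ν (y n)) ((P : ℤ), 0))
    {J : ℤ} {n : ℤ × ℤ} (h1 : J < n.2) (h2 : n.2 ≤ J + w) (hne : x n ≠ y n) :
    ∃ n ∈ block P w J, x n ≠ y n := by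
  have hP' : (0 : ℤ) < P := by omega
  refine ⟨n + (-(n.1 / P)) • ((P : ℤ), (0 : ℤ)), mem_block.2 ?_, fun heq => hne ?_⟩
  · have e1 : (n + (-(n.1 / P)) • ((P : ℤ), (0 : ℤ))).1 = n.1 % P := by
      have := Int.emod_add_mul_ediv n.1 P
      simp only [Prod.fst_add, Prod.smul_fst, smul_eq_mul]
      linarith
    have e2 : (n + (-(n.1 / P)) • ((P : ℤ), (0 : ℤ))).2 = n.2 := by simp
    rw [e1, e2]
    exact ⟨⟨Int.emod_nonneg _ hP'.ne', Int.emod_lt_of_pos _ hP'⟩, h1, h2⟩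
  · have h := hper.zsmul (-(n.1 / P)) n
    rw [heq, sub_self] at h
    exact hν (sub_eq_zero.1 h.symm)

lemma isClosed_families {A : Type*} [TopologicalSpace A] [DiscreteTopology A]
    {X : Set (ℤ × ℤ → A)} (hX : IsClosed X) (ν : A → ℤ) (P w N : ℕ) :
    IsClosed (families X ν P w N) := by
  have hc : ∀ (i : Fin N) (n : ℤ × ℤ), Continuous fun b : Fin N → ℤ × ℤ → A => b i n :=
    fun i n => (continuous_apply n).comp (continuous_apply i)
  have hcν : ∀ (i : Fin N) (n : ℤ × ℤ), Continuous fun b : Fin N → ℤ × ℤ → A => ν (b i n) :=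
    fun i n => continuous_of_discreteTopology.comp (hc i n)
  refine IsClosed.inter (s₁ := {b : Fin N → ℤ × ℤ → A | ∀ i, b i ∈ X}) ?_ (IsClosed.inter
    (s₁ := {b : Fin N → ℤ × ℤ → A | ∀ i j, Function.Periodic (fun n => ν (b i n) - ν (b j n)) ((P : ℤ), 0)})
    (s₂ := {b : Fin N → ℤ × ℤ → A | ∀ i j, i ≠ j → ∀ J : ℤ, ∃ n ∈ block P w J, b i n ≠ b j n}) ?_ ?_)
  · simp only [Set.ofPred_forall]
    exact isClosed_iInter fun i => hX.preimage (continuous_apply i)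
  · simp only [Function.Periodic, Set.ofPred_forall]
    exact isClosed_iInter fun i => isClosed_iInter fun j => isClosed_iInter fun n =>
      isClosed_eq ((hcν i _).sub (hcν j _)) ((hcν i _).sub (hcν j _))
  · simp only [Set.ofPred_forall]
    refine isClosed_iInter fun i => isClosed_iInter fun j => isClosed_iInter fun _ =>
      isClosed_iInter fun J => ?_
    have : {b : Fin N → ℤ × ℤ → A | ∃ n ∈ block P w J, b i n ≠ b j n} =
        ⋃ n ∈ block P w J, {b : Fin N → ℤ × ℤ → A | b i n ≠ b j n} := by
      ext b
      simp
    rw [this]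
    refine (block P w J).finite_toSet.isClosed_biUnion fun n _ => ?_
    exact (isClosed_discrete {q : A × A | q.1 ≠ q.2}).preimage ((hc i n).prodMk (hc j n))

/-- In a minimal subshift, any point occurs as the first member of a family. -/
lemma exists_family_eq {A : Type*} [Finite A] [TopologicalSpace A] [DiscreteTopology A]
    {X : Set (ℤ × ℤ → A)} (hX : IsMinimalSubshift X) {ν : A → ℤ} (hν : Function.Injective ν)
    {P w N : ℕ} (hP : P ≠ 0) (hne : (families X ν P w (N + 1)).Nonempty)
    {x : ℤ × ℤ → A} (hx : x ∈ X) : ∃ b ∈ families X ν P w (N + 1), b 0 = x := by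
  have hY : (fun b : Fin (N + 1) → ℤ × ℤ → A => b 0) '' families X ν P w (N + 1) = X := by
    refine hX.eq_of_subset _ ?_ ⟨hne.image _, ?_, ?_⟩
    · rintro _ ⟨b, hb, rfl⟩
      exact hb.1 0
    · exact ((isClosed_families hX.isClosed ν P w (N + 1)).isCompact.image
        (continuous_apply 0)).isClosed
    · rintro _ ⟨b, hb, rfl⟩ t
      have hper : ∀ i j, Function.Periodic (fun n => ν (b i (n + t)) - ν (b j (n + t)))
          ((P : ℤ), 0) := fun i j n => by
        have := hb.2.1 i j (n + t)
        simp only at this ⊢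
        rw [add_right_comm, this]
      refine ⟨fun i n => b i (n + t), ⟨fun i => hX.shift_mem _ (hb.1 i) t, hper, ?_⟩, rfl⟩
      intro i j hij J
      obtain ⟨n, hn, hne⟩ := hb.2.2 i j hij (J + t.2)
      rw [mem_block] at hn
      refine exists_block_ne hν hP (hper i j) (n := n - t) ?_ ?_ (by simpa using hne)
      · simp only [Prod.snd_sub]
        omega
      · simp only [Prod.snd_sub]
        omega
  rw [← hY] at hx
  exact hx

lemma card_le_of_families {A : Type*} [Finite A] {X : Set (ℤ × ℤ → A)} {ν : A → ℤ}
    {P w N : ℕ} (hne : (families X ν P w N).Nonempty) : N ≤ Nat.card (block P w 0 → A) := by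
  obtain ⟨b, hb⟩ := hne
  have hinj : Function.Injective fun (i : Fin N) (n : block P w 0) => b i n := by
    intro i j hij
    by_contra hne
    obtain ⟨n, hn, h⟩ := hb.2.2 i j hne 0
    exact h (congrFun hij ⟨n, hn⟩)
  simpa using Nat.card_le_card_of_injective _ hinj

/-- Moving far up a finite family of points with periodic pairwise differences that are
distinct on all high strips yields a family that is distinct on all strips. -/
lemma families_nonempty_of_eventually {A : Type*} [Finite A] [TopologicalSpace A]
    [DiscreteTopology A] {X : Set (ℤ × ℤ → A)} (hX : IsSubshift X) {ν : A → ℤ}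
    (hν : Function.Injective ν) {P w N : ℕ} (hP : P ≠ 0) {b : Fin N → ℤ × ℤ → A}
    (hb : ∀ i, b i ∈ X)
    (hper : ∀ i j, Function.Periodic (fun n => ν (b i n) - ν (b j n)) ((P : ℤ), 0))
    (hne : ∀ i j, i ≠ j → ∀ᶠ J : ℤ in atTop, ∃ n : ℤ × ℤ, J < n.2 ∧ n.2 ≤ J + w ∧ b i n ≠ b j n) :
    (families X ν P w N).Nonempty := by
  have hlim : ∀ i, ∃ z ∈ X, ∀ n, ∀ᶠ m : ℕ in (hyperfilter ℕ : Filter ℕ),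
      b i (n + (0, (m : ℤ))) = z n := fun i =>
    exists_limit hX.isClosed (fun m n => b i (n + (0, (m : ℤ)))) fun m => hX.shift_mem _ (hb i) _
  choose z hz hlim using hlim
  have hper' : ∀ i j, Function.Periodic (fun n => ν (z i n) - ν (z j n)) ((P : ℤ), 0) := by
    intro i j n
    obtain ⟨m, ⟨⟨h1, h2⟩, h3⟩, h4⟩ := ((((hlim i n).and (hlim j n)).and
      (hlim i (n + ((P : ℤ), 0)))).and (hlim j (n + ((P : ℤ), 0)))).exists
    simp only
    rw [← h1, ← h2, ← h3, ← h4, add_right_comm]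
    exact hper i j _
  refine ⟨z, hz, hper', fun i j hij J => ?_⟩
  have h1 : ∀ᶠ m : ℕ in atTop, ∃ n : ℤ × ℤ, J + m < n.2 ∧ n.2 ≤ J + m + w ∧ b i n ≠ b j n :=
    (tendsto_atTop_add_const_left _ J tendsto_natCast_atTop_atTop).eventually (hne i j hij)
  have h2 : ∀ᶠ m : ℕ in (hyperfilter ℕ : Filter ℕ), ∀ n ∈ block P w J,
      b i (n + (0, (m : ℤ))) = z i n ∧ b j (n + (0, (m : ℤ))) = z j n :=
    (eventually_all_finset _).2 fun n _ => (hlim i n).and (hlim j n)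
  obtain ⟨m, ⟨n, hn1, hn2, hn⟩, h2⟩ := ((eventually_hyperfilter_of_atTop h1).and h2).exists
  have hper'' : Function.Periodic
      (fun n => ν (b i (n + (0, (m : ℤ)))) - ν (b j (n + (0, (m : ℤ))))) ((P : ℤ), 0) := by
    intro n
    have := hper i j (n + (0, (m : ℤ)))
    simp only at this ⊢
    rw [add_right_comm, this]
  obtain ⟨n', hn', hne'⟩ := exists_block_ne hν hP hper'' (J := J) (w := w) (n := n - (0, (m : ℤ)))
    (by simp only [Prod.snd_sub]; omega) (by simp only [Prod.snd_sub]; omega) (by simpa using hn)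
  refine ⟨n', hn', ?_⟩
  rw [← (h2 n' hn').1, ← (h2 n' hn').2]
  exact hne'

/-- If the upper half plane determines the points of a subshift, then so do finitely many
rows of it, uniformly. -/
lemma exists_strip_determines {A : Type*} [Finite A] [TopologicalSpace A] [DiscreteTopology A]
    {X : Set (ℤ × ℤ → A)} (hX : IsSubshift X)
    (hdet : ∀ x ∈ X, ∀ y ∈ X, (∀ n : ℤ × ℤ, 0 < n.2 → x n = y n) → x 0 = y 0) :
    ∃ w : ℕ, ∀ x ∈ X, ∀ y ∈ X, ∀ J : ℤ, (∀ n : ℤ × ℤ, J < n.2 → n.2 ≤ J + w → x n = y n) →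
      ∀ n : ℤ × ℤ, n.2 ≤ J + w → x n = y n := by
  obtain ⟨w, hw⟩ : ∃ w : ℕ, ∀ x ∈ X, ∀ y ∈ X,
      (∀ n : ℤ × ℤ, 0 < n.2 → n.2 ≤ w → x n = y n) → x 0 = y 0 := by
    by_contra! hcon
    choose x hx y hy heq hne using hcon
    obtain ⟨x', hx', hxlim⟩ := exists_limit hX.isClosed x hx
    obtain ⟨y', hy', hylim⟩ := exists_limit hX.isClosed y hy
    obtain ⟨m, h1, h2⟩ := ((hxlim 0).and (hylim 0)).exists
    refine hne m ?_
    rw [h1, h2]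
    refine hdet x' hx' y' hy' fun n hn => ?_
    have h3 := eventually_hyperfilter_of_atTop (eventually_ge_atTop n.2.toNat)
    obtain ⟨m, ⟨h1, h2⟩, h3⟩ := (((hxlim n).and (hylim n)).and h3).exists
    rw [← h1, ← h2]
    exact heq m n hn (by omega)
  refine ⟨w, fun x hx y hy J heq => ?_⟩
  have hdown : ∀ k : ℕ, ∀ n : ℤ × ℤ, J - k < n.2 → n.2 ≤ J + w → x n = y n := by
    intro k
    induction k with
    | zero => simpa using heq
    | succ k ih =>
      intro n h1 h2
      by_cases h3 : J - k < n.2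
      · exact ih n h3 h2
      · have := hw _ (hX.shift_mem x hx n) _ (hX.shift_mem y hy n) fun s hs1 hs2 => by
          refine ih _ ?_ ?_
          · simp only [Prod.snd_add]
            push_cast at h1
            omega
          · simp only [Prod.snd_add]
            omega
        simpa using this
  intro n hn
  exact hdown (J - n.2 + 1).toNat n (by omega) hn

/-- Suppose that points of a minimal subshift agreeing on a lower half plane have periodic
differences. If the subshift is non-deterministic upwards, it is so downwards. -/
lemma exists_nondeterministic_down {A : Type*} [Finite A] [TopologicalSpace A]
    [DiscreteTopology A] {X : Set (ℤ × ℤ → A)} (hX : IsMinimalSubshift X) {ν : A → ℤ}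
    (hν : Function.Injective ν) {P : ℕ} (hP : P ≠ 0)
    (hper : ∀ x ∈ X, ∀ y ∈ X, (∀ n : ℤ × ℤ, n.2 < 0 → x n = y n) →
      Function.Periodic (fun n => ν (x n) - ν (y n)) ((P : ℤ), 0))
    (hup : ∃ x ∈ X, ∃ y ∈ X, (∀ n : ℤ × ℤ, n.2 < 0 → x n = y n) ∧ x 0 ≠ y 0) :
    ∃ x ∈ X, ∃ y ∈ X, (∀ n : ℤ × ℤ, 0 < n.2 → x n = y n) ∧ x 0 ≠ y 0 := by
  by_contra! hdet
  obtain ⟨w, hw⟩ := exists_strip_determines hX.toIsSubshift hdet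
  obtain ⟨x, hx, y, hy, hxy, hne⟩ := hup
  have hev : ∀ x ∈ X, ∀ y ∈ X, x ≠ y →
      ∀ᶠ J : ℤ in atTop, ∃ n : ℤ × ℤ, J < n.2 ∧ n.2 ≤ J + w ∧ x n ≠ y n := by
    intro x hx y hy hne
    obtain ⟨p, hp⟩ := Function.ne_iff.1 hne
    filter_upwards [eventually_ge_atTop p.2] with J hJ
    by_contra! hcon
    exact hp (hw x hx y hy J hcon p (by omega))
  have hall : ∀ N : ℕ, (families X ν P w (N + 1)).Nonempty := by
    intro N
    induction N with
    | zero =>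
      refine ⟨fun _ => x, fun _ => hx, fun _ _ n => by simp, fun i j hij => ?_⟩
      exact absurd (Fin.ext (by omega)) hij
    | succ N ih =>
      obtain ⟨b, hb, hb0⟩ := exists_family_eq hX hν hP ih hx
      have hby : ∀ j, Function.Periodic (fun n => ν (b j n) - ν (y n)) ((P : ℤ), 0) := by
        intro j n
        have h1 := hb.2.1 j 0 n
        have h2 := hper x hx y hy hxy n
        simp only [hb0] at h1 h2 ⊢
        linarith
      have hyne : ∀ j, b j ≠ y := by
        intro j
        by_cases hj : j = 0
        · rw [hj, hb0]
          exact fun h => hne (congrFun h 0)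
        · obtain ⟨n, hn, hnj⟩ := hb.2.2 j 0 hj (-w - 1)
          rw [mem_block] at hn
          rw [hb0, hxy n (by omega)] at hnj
          exact fun h => hnj (congrFun h n)
      have hmem : ∀ i, (Fin.cons y b : Fin (N + 2) → ℤ × ℤ → A) i ∈ X :=
        Fin.cases hy hb.1
      refine families_nonempty_of_eventually hX.toIsSubshift hν hP (b := Fin.cons y b) hmem ?_ ?_
      · refine Fin.cases (Fin.cases ?_ fun j => ?_) fun i => Fin.cases ?_ fun j => ?_
        · intro n
          simp
        · intro n
          have := hby j n
          simp only [Fin.cons_zero, Fin.cons_succ] at this ⊢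
          linarith
        · simpa using hby i
        · simpa using hb.2.1 i j
      · intro i j hij
        refine hev _ (hmem i) _ (hmem j) ?_
        revert hij
        refine Fin.cases (Fin.cases ?_ fun j => ?_) (fun i => Fin.cases ?_ fun j => ?_) i j
        · simp
        · exact fun _ => by simpa using (hyne j).symm
        · exact fun _ => by simpa using hyne i
        · intro hij heq
          obtain ⟨n, -, hn⟩ := hb.2.2 i j (fun h => hij (congrArg _ h)) 0
          exact hn (congrFun (by simpa using heq) n)
  have := card_le_of_families (hall (Nat.card (block P w 0 → A)))
  omega

end OneSided

section MorseHedlund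

/-- The word of length `n` of `u` at position `k`. -/
def word {A : Type*} (u : ℤ → A) (n : ℕ) (k : ℤ) : Fin n → A := fun i => u (k + (i : ℕ))

lemma word_succ_eq {A : Type*} {u v : ℤ → A} {n : ℕ} {k l : ℤ} (h : word u n k = word v n l)
    (hne : u (k + n) = v (l + n)) : word u (n + 1) k = word v (n + 1) l := by
  funext i
  refine Fin.lastCases ?_ (fun i => ?_) i
  · simpa [word] using hne
  · simpa [word] using congrFun h i

/-- If words of length `n` have a unique extension to the right then equality of two of them
propagates to the right. -/
lemma eq_of_word_eq {A : Type*} {u v : ℤ → A} {n : ℕ} {k l : ℤ}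
    (hext : ∀ s : ℕ, word u n (k + s) = word v n (l + s) → u (k + s + n) = v (l + s + n))
    (h : word u n k = word v n l) (s : ℕ) : u (k + s) = v (l + s) := by
  have hw : ∀ s : ℕ, word u n (k + s) = word v n (l + s) := by
    intro s
    induction s with
    | zero => simpa using h
    | succ s ih =>
      have h1 := word_succ_eq ih (hext s ih)
      funext i
      have h2 := congrFun h1 i.succ
      simp only [word, Fin.val_succ, Nat.cast_add, Nat.cast_one] at h2 ⊢
      rw [show k + (s + 1) + (i : ℕ) = k + s + ((i : ℕ) + 1) by ring, h2]
      congr 1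
      ring
  cases n with
  | zero => simpa using hext s (hw s)
  | succ n => simpa [word] using congrFun (hw s) 0

/-- Eventual periods bounded by `N` with arbitrary starting points yield the period `N!`. -/
lemma periodic_factorial {A : Type*} {u : ℤ → A} {N : ℕ} {Q D : ℤ}
    (h : ∀ a : ℤ, ∃ p : ℕ, 1 ≤ p ∧ p ≤ N ∧ ∀ i, a + D ≤ i → u (i + p * Q) = u i) (hQ : 0 ≤ Q) :
    Function.Periodic u (N.factorial * Q) := by
  intro i
  obtain ⟨p, hp1, hpN, hp⟩ := h (i - D)
  obtain ⟨q, hq⟩ := Nat.dvd_factorial hp1 hpN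
  have hmul : ∀ q : ℕ, u (i + q * (p * Q)) = u i := by
    intro q
    induction q with
    | zero => simp
    | succ q ih =>
      have h1 : (0 : ℤ) ≤ q * (p * Q) := by positivity
      rw [← ih, ← hp (i + q * (p * Q)) (by omega)]
      congr 1
      push_cast
      ring
  rw [← hmul q, hq]
  congr 1
  push_cast
  ring

/-- The Morse–Hedlund theorem for two-sided sequences. -/
lemma periodic_of_ncard_words_le {A : Type*} [Finite A] {u : ℤ → A} {n : ℕ}
    (h : (Set.range (word u n)).ncard ≤ n) : Function.Periodic u (n.factorial : ℤ) := by
  have hstep : ∀ m : ℕ, (Set.range (word u m)).ncard ≤ m → ∃ j < m,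
      (Set.range (word u (j + 1))).ncard ≤ (Set.range (word u j)).ncard ∧
      (Set.range (word u j)).ncard ≤ m := by
    intro m
    induction m with
    | zero =>
      intro h0
      have := (Set.ncard_pos (Set.toFinite _)).2 (Set.range_nonempty (word u 0))
      omega
    | succ m ih =>
      intro hm
      by_cases h1 : (Set.range (word u m)).ncard ≤ m
      · obtain ⟨j, hj, h2, h3⟩ := ih h1
        exact ⟨j, by omega, h2, by omega⟩
      · by_cases h2 : (Set.range (word u m)).ncard ≤ m + 1
        · exact ⟨m, by omega, by omega, h2⟩
        · exfalso
          have h3 : Set.range (word u m) =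
              (fun (p : Fin (m + 1) → A) (i : Fin m) => p i.castSucc) '' Set.range (word u (m + 1)) := by
            rw [← Set.range_comp]
            congr
          have := Set.ncard_image_le (f := fun (p : Fin (m + 1) → A) (i : Fin m) => p i.castSucc)
            (Set.toFinite (Set.range (word u (m + 1))))
          rw [← h3] at this
          omega
  obtain ⟨j, hj, hle, hjn⟩ := hstep n h
  have hext : ∀ k l : ℤ, word u j k = word u j l → u (k + j) = u (l + j) := by
    have h3 : Set.range (word u j) =
        (fun (p : Fin (j + 1) → A) (i : Fin j) => p i.castSucc) '' Set.range (word u (j + 1)) := by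
      rw [← Set.range_comp]
      congr
    rw [h3] at hle
    have hinj := Set.injOn_of_ncard_image_eq
      (le_antisymm (Set.ncard_image_le (Set.toFinite _)) hle) (Set.toFinite _)
    intro k l hkl
    have := hinj (Set.mem_range_self k) (Set.mem_range_self l) hkl
    simpa [word] using congrFun this (Fin.last j)
  have hper : Function.Periodic u ((n.factorial : ℤ) * 1) := by
    refine periodic_factorial (D := n) (fun a => ?_) zero_le_one
    obtain ⟨s, hs, t, ht, hst, heq⟩ : ∃ s ≤ n, ∃ t ≤ n, s < t ∧
        word u j (a + s) = word u j (a + t) := by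
      have hmaps : Set.MapsTo (fun s : ℕ => word u j (a + s)) (Finset.range (n + 1))
          (Set.toFinite (Set.range (word u j))).toFinset := fun s _ => by simp
      obtain ⟨s, hs, t, ht, hst, heq⟩ := Finset.exists_ne_map_eq_of_card_lt_of_maps_to
        (by rw [← Set.ncard_eq_toFinset_card, Finset.card_range]; omega) hmaps
      simp only [Finset.mem_range] at hs ht
      rcases lt_or_gt_of_ne hst with h | h
      · exact ⟨s, by omega, t, by omega, h, heq⟩
      · exact ⟨t, by omega, s, by omega, h, heq.symm⟩
    refine ⟨t - s, by omega, by omega, fun i hi => ?_⟩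
    have := eq_of_word_eq (fun q hq => hext _ _ hq) heq (i - a - s).toNat
    rw [show ((i - a - s).toNat : ℤ) = i - a - s by omega] at this
    rw [show i + ((t - s : ℕ) : ℤ) * 1 = a + t + (i - a - s) by omega, ← this]
    congr 1
    omega
  simpa using hper

end MorseHedlund

section Propagation

/-- Once two points agree on `H` consecutive rows, equality on `w` consecutive cells of the next
row propagates to both neighbouring cells. -/
structure Propagates {A : Type*} (X : Set (ℤ × ℤ → A)) (H w : ℕ) : Prop where
  right : ∀ x ∈ X, ∀ y ∈ X, ∀ J k : ℤ, (∀ n : ℤ × ℤ, J - H ≤ n.2 → n.2 < J → x n = y n) →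
    (∀ i : ℤ, 0 ≤ i → i < w → x (k + i, J) = y (k + i, J)) → x (k + w, J) = y (k + w, J)
  left : ∀ x ∈ X, ∀ y ∈ X, ∀ J k : ℤ, (∀ n : ℤ × ℤ, J - H ≤ n.2 → n.2 < J → x n = y n) →
    (∀ i : ℤ, 0 ≤ i → i < w → x (k + i, J) = y (k + i, J)) → x (k - 1, J) = y (k - 1, J)

lemma Propagates.row_eq {A : Type*} {X : Set (ℤ × ℤ → A)} {H w : ℕ} (hX : Propagates X H w)
    {x y : ℤ × ℤ → A} (hx : x ∈ X) (hy : y ∈ X) {J k : ℤ}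
    (hstrip : ∀ n : ℤ × ℤ, J - H ≤ n.2 → n.2 < J → x n = y n)
    (hrow : ∀ i : ℤ, 0 ≤ i → i < w → x (k + i, J) = y (k + i, J)) (i : ℤ) :
    x (i, J) = y (i, J) := by
  rcases le_or_gt k i with h | h
  · have := eq_of_word_eq (u := fun i => x (i, J)) (v := fun i => y (i, J)) (n := w) (k := k)
      (l := k) (fun s hs => hX.right x hx y hy J (k + s) hstrip fun i h0 h1 => ?_) ?_ (i - k).toNat
    · simp only [show k + ((i - k).toNat : ℤ) = i by omega] at this
      exact this
    · have := congrFun hs ⟨i.toNat, by omega⟩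
      simp only [word, Int.toNat_of_nonneg h0] at this
      exact this
    · funext i
      exact hrow i (by omega) (by omega)
  · have := eq_of_word_eq (u := fun i => x (-i, J)) (v := fun i => y (-i, J)) (n := w)
      (k := -(k + w - 1)) (l := -(k + w - 1)) (fun s hs => ?_) ?_ (w + (k - 1 - i)).toNat
    · simp only [show -(-(k + w - 1) + ((w + (k - 1 - i)).toNat : ℤ)) = i by omega] at this
      exact this
    · have := hX.left x hx y hy J (k - s) hstrip fun i h0 h1 => ?_
      · simp only [show -(-(k + w - 1) + (s : ℤ) + w) = k - s - 1 by ring]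
        exact this
      · have := congrFun hs ⟨(w - 1 - i).toNat, by omega⟩
        simp only [word, show -(-(k + w - 1) + (s : ℤ) + ((w - 1 - i).toNat : ℕ)) = k - s + i by
          omega] at this
        exact this
    · funext i
      have := hrow (w - 1 - (i : ℕ)) (by omega) (by omega)
      simp only [word, show -(-(k + w - 1) + ((i : ℕ) : ℤ)) = k + (w - 1 - (i : ℕ)) by ring]
      exact this

/-- The `C`-patterns of points of `X` that are compatible with two contents of the cells
`(0, 0), …, (w, 0)`. -/
def ambiguousPatterns {A : Type*} (X : Set (ℤ × ℤ → A)) (C : Finset (ℤ × ℤ)) (w : ℕ) :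
    Set (C → A) :=
  {p | ∃ x ∈ X, ∃ y ∈ X, (∀ c ∈ C, x c = y c) ∧ (∃ i : ℤ, 0 ≤ i ∧ i ≤ w ∧ x (i, 0) ≠ y (i, 0)) ∧
    p = fun c : C => x c}

/-- The content of the window `C + n` in `x` does not determine the cells of `x` above it. -/
def IsAmbiguous {A : Type*} (X : Set (ℤ × ℤ → A)) (C : Finset (ℤ × ℤ)) (w : ℕ)
    (x : ℤ × ℤ → A) (n : ℤ × ℤ) : Prop :=
  ∃ y ∈ X, (∀ c ∈ C, x (c + n) = y (c + n)) ∧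
    ∃ i : ℤ, 0 ≤ i ∧ i ≤ w ∧ x ((i, 0) + n) ≠ y ((i, 0) + n)

lemma strip_periodic {A : Type*} [Finite A] [TopologicalSpace A] {X : Set (ℤ × ℤ → A)}
    (hX : IsSubshift X) {C : Finset (ℤ × ℤ)} {w : ℕ}
    (hcount : (ambiguousPatterns X C w).ncard ≤ w) {x : ℤ × ℤ → A} (hx : x ∈ X) {J r o : ℤ}
    (hrow : ∀ i : ℤ, 0 ≤ i → i < w → (o + i, r) ∈ C)
    (hamb : ∀ k : ℤ, IsAmbiguous X C w x (k, J)) :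
    Function.Periodic (fun i => x (i, J + r)) (w.factorial : ℤ) := by
  refine periodic_of_ncard_words_le (le_trans ?_ hcount)
  refine le_trans (Set.ncard_le_ncard ?_ (Set.toFinite _)) (Set.ncard_image_le
    (f := fun (p : C → A) (i : Fin w) => p ⟨(o + (i : ℕ), r), hrow _ (by omega) (by omega)⟩)
    (Set.toFinite _))
  rintro _ ⟨k, rfl⟩
  obtain ⟨y, hy, h1, i, h2, h3, h4⟩ := hamb (k - o)
  refine ⟨_, ⟨_, hX.shift_mem x hx (k - o, J), _, hX.shift_mem y hy (k - o, J), h1,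
    ⟨i, h2, h3, h4⟩, rfl⟩, ?_⟩
  funext i
  simp only [word]
  congr 1
  ext <;> simp only [Prod.fst_add, Prod.snd_add] <;> ring

lemma Propagates.row_periodic {A : Type*} [Finite A] [TopologicalSpace A] {X : Set (ℤ × ℤ → A)}
    (hX : IsSubshift X) {H w : ℕ} (hprop : Propagates X H w) {x : ℤ × ℤ → A} (hx : x ∈ X)
    {J : ℤ} {Q : ℕ} (hstrip : ∀ n : ℤ × ℤ, J - H ≤ n.2 → n.2 < J → x (n + ((Q : ℤ), 0)) = x n) :
    Function.Periodic (fun i => x (i, J)) (((Nat.card (Fin w → A)).factorial : ℤ) * Q) := by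
  have hmul : ∀ s : ℕ, ∀ n : ℤ × ℤ, J - H ≤ n.2 → n.2 < J → x (n + ((s : ℤ) * Q, 0)) = x n := by
    intro s
    induction s with
    | zero => intro n _ _; simp [show n + (0, 0) = n from add_zero n]
    | succ s ih =>
      intro n h1 h2
      rw [← ih n h1 h2, ← hstrip (n + ((s : ℤ) * Q, 0)) (by simpa using h1) (by simpa using h2)]
      congr 1
      ext
      · simp only [Prod.fst_add]
        push_cast
        ring
      · simp
  refine periodic_factorial (D := Nat.card (Fin w → A) * Q) (fun a => ?_) (by positivity)
  obtain ⟨s, hs, t, ht, hst, heq⟩ : ∃ s ≤ Nat.card (Fin w → A), ∃ t ≤ Nat.card (Fin w → A), s < t ∧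
      word (fun i => x (i, J)) w (a + s * Q) = word (fun i => x (i, J)) w (a + t * Q) := by
    have := Fintype.ofFinite (Fin w → A)
    obtain ⟨s, hs, t, ht, hst, heq⟩ := Finset.exists_ne_map_eq_of_card_lt_of_maps_to
      (s := Finset.range (Nat.card (Fin w → A) + 1)) (t := Finset.univ)
      (f := fun s : ℕ => word (fun i => x (i, J)) w (a + s * Q))
      (by rw [Finset.card_range, Finset.card_univ, Nat.card_eq_fintype_card]; omega)
      (fun s _ => by simp)
    simp only [Finset.mem_range] at hs ht
    rcases lt_or_gt_of_ne hst with h | h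
    · exact ⟨s, by omega, t, by omega, h, heq⟩
    · exact ⟨t, by omega, s, by omega, h, heq.symm⟩
  refine ⟨t - s, by omega, by omega, fun i hi => ?_⟩
  have hsQ : (s : ℤ) * Q ≤ Nat.card (Fin w → A) * Q := by gcongr
  have := eq_of_word_eq (fun q hq => ?_) heq (i - a - s * Q).toNat
  · rw [Int.toNat_of_nonneg (by linarith)] at this
    rw [show a + s * Q + (i - a - s * Q) = i by ring] at this
    rw [this, Nat.cast_sub hst.le]
    congr 2
    ring
  · have hr := hprop.right _ (hX.shift_mem x hx ((s : ℤ) * Q, 0)) _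
      (hX.shift_mem x hx ((t : ℤ) * Q, 0)) J (a + q)
      (fun n h1 h2 => by rw [hmul s n h1 h2, hmul t n h1 h2]) (fun i h0 h1 => ?_)
    · simp only [Prod.mk_add_mk, add_zero] at hr
      rw [show a + s * Q + q + w = a + q + w + s * Q by ring,
        show a + t * Q + q + w = a + q + w + t * Q by ring]
      exact hr
    · have := congrFun hq ⟨i.toNat, by omega⟩
      simp only [word, Int.toNat_of_nonneg h0] at this
      simp only [Prod.mk_add_mk, add_zero]
      rw [show a + s * Q + q + i = a + q + i + s * Q by ring,
        show a + t * Q + q + i = a + q + i + t * Q by ring] at this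
      exact this

/-- Non-determinism upwards together with few ambiguous patterns and propagation along rows
forces the existence of a horizontally periodic point. -/
lemma Propagates.exists_periodic {A : Type*} [Finite A] [TopologicalSpace A] [DiscreteTopology A]
    {X : Set (ℤ × ℤ → A)} (hX : IsSubshift X) {H w : ℕ} (hprop : Propagates X H w)
    {C : Finset (ℤ × ℤ)} (hC : ∀ n ∈ C, -(H : ℤ) ≤ n.2 ∧ n.2 < 0)
    (hrow : ∀ r : ℤ, -(H : ℤ) ≤ r → r < 0 → ∃ o : ℤ, ∀ i : ℤ, 0 ≤ i → i < w → (o + i, r) ∈ C)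
    (hcount : (ambiguousPatterns X C w).ncard ≤ w)
    (hup : ∃ x ∈ X, ∃ y ∈ X, (∀ n : ℤ × ℤ, n.2 < 0 → x n = y n) ∧ x 0 ≠ y 0) :
    ∃ z ∈ X, ∃ Q : ℤ, Q ≠ 0 ∧ Function.Periodic z (Q, 0) := by
  obtain ⟨x, hx, y, hy, hxy, hne⟩ := hup
  have hstrip : ∀ J : ℤ, (∀ k : ℤ, IsAmbiguous X C w x (k, J)) → ∀ n : ℤ × ℤ, J - H ≤ n.2 →
      n.2 < J → x (n + ((w.factorial : ℤ), 0)) = x n := by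
    intro J hamb n h1 h2
    obtain ⟨o, ho⟩ := hrow (n.2 - J) (by omega) (by omega)
    have := strip_periodic hX hcount hx ho hamb n.1
    simp only [add_sub_cancel] at this
    simpa [Prod.add_def] using this
  set M := Nat.card (Fin w → A) with hM
  set Q : ℕ := M.factorial * w.factorial with hQ
  have hbase : ∀ n : ℤ × ℤ, -(H : ℤ) ≤ n.2 → n.2 < 0 → x (n + ((Q : ℤ), 0)) = x n := by
    have h0 := hstrip 0 fun k => by
      by_contra hcon
      refine hne ?_
      have hagree : ∀ i : ℤ, 0 ≤ i → i ≤ w → x ((i, 0) + (k, 0)) = y ((i, 0) + (k, 0)) := by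
        intro i h1 h2
        by_contra h
        exact hcon ⟨y, hy, fun c hc => hxy _ (by simpa using (hC c hc).2), i, h1, h2, h⟩
      refine hprop.row_eq hx hy (k := k) (fun n _ h => hxy n h) (fun i h1 h2 => ?_) 0
      have := hagree i h1 h2.le
      simpa [add_comm] using this
    have hmul : ∀ q : ℕ, ∀ n : ℤ × ℤ, -(H : ℤ) ≤ n.2 → n.2 < 0 →
        x (n + (((q * w.factorial : ℕ) : ℤ), 0)) = x n := by
      intro q
      induction q with
      | zero => intro n _ _; simp [show n + (0, 0) = n from add_zero n]
      | succ q ih =>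
        intro n h1 h2
        rw [← ih n h1 h2, ← h0 (n + (((q * w.factorial : ℕ) : ℤ), 0)) (by simpa using h1)
          (by simpa using h2)]
        congr 1
        ext
        · simp only [Prod.fst_add]
          push_cast
          ring
        · simp
    exact hmul _
  have hrows : ∀ k : ℕ, ∀ n : ℤ × ℤ, -(H : ℤ) ≤ n.2 → n.2 < k → x (n + ((Q : ℤ), 0)) = x n := by
    intro k
    induction k with
    | zero => simpa using hbase
    | succ k ih =>
      intro n h1 h2
      rcases lt_or_ge n.2 k with h3 | h3
      · exact ih n h1 h3
      have hn : n = (n.1, (k : ℤ)) := Prod.ext rfl (by simp only; omega)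
      by_cases hamb : ∀ j : ℤ, IsAmbiguous X C w x (j, k)
      · have := hprop.row_periodic hX hx (hstrip k hamb) n.1
        rw [hn]
        simpa [hQ, hM] using this
      · push Not at hamb
        obtain ⟨j, hj⟩ := hamb
        have hagree : ∀ i : ℤ, 0 ≤ i → i ≤ w →
            x ((i, 0) + (j, (k : ℤ))) = x ((i, 0) + (j, (k : ℤ)) + ((Q : ℤ), 0)) := by
          intro i h4 h5
          by_contra h
          refine hj ⟨_, hX.shift_mem x hx ((Q : ℤ), 0), fun c hc => ?_, i, h4, h5, h⟩
          have := hC c hc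
          refine (ih _ ?_ ?_).symm <;> simp only [Prod.snd_add] <;> omega
        have := hprop.row_eq hx (hX.shift_mem x hx ((Q : ℤ), 0)) (J := k) (k := j)
          (fun n h4 h5 => (ih n (by omega) h5).symm)
          (fun i h4 h5 => by simpa [add_comm] using hagree i h4 h5.le) n.1
        rw [hn]
        exact this.symm
  obtain ⟨z, hz, hlim⟩ := exists_limit hX.isClosed (fun (m : ℕ) n => x (n + (0, (m : ℤ))))
    fun m => hX.shift_mem x hx _
  refine ⟨z, hz, Q, by positivity, fun n => ?_⟩
  obtain ⟨m, ⟨h1, h2⟩, h3⟩ := (((hlim n).and (hlim (n + ((Q : ℤ), 0)))).and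
    (eventually_hyperfilter_of_atTop (eventually_ge_atTop (-n.2).toNat))).exists
  rw [← h1, ← h2, add_right_comm]
  refine hrows (n.2 + m + 1).toNat _ ?_ ?_ <;> simp only [Prod.snd_add] <;> omega

end Propagation

section Complexity

/-- The number of patterns of shape `B` in `X`. -/
noncomputable def complexity {A : Type*} (X : Set (ℤ × ℤ → A)) (B : Finset (ℤ × ℤ)) : ℕ :=
  ((fun (x : ℤ × ℤ → A) (b : B) => x b) '' X).ncard

lemma image_restrict {A : Type*} (X : Set (ℤ × ℤ → A)) {B C : Finset (ℤ × ℤ)} (hCB : C ⊆ B) :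
    (fun (p : B → A) (c : C) => p ⟨c, hCB c.2⟩) '' ((fun (x : ℤ × ℤ → A) (b : B) => x b) '' X) =
      (fun (x : ℤ × ℤ → A) (c : C) => x c) '' X := by
  rw [Set.image_image]

lemma eq_of_complexity_le {A : Type*} [Finite A] {X : Set (ℤ × ℤ → A)} {B C : Finset (ℤ × ℤ)}
    (hCB : C ⊆ B) (h : complexity X B ≤ complexity X C) {x y : ℤ × ℤ → A} (hx : x ∈ X)
    (hy : y ∈ X) (hxy : ∀ c ∈ C, x c = y c) {b : ℤ × ℤ} (hb : b ∈ B) : x b = y b := by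
  unfold complexity at h
  rw [← image_restrict X hCB] at h
  have hinj := Set.injOn_of_ncard_image_eq
    (le_antisymm (Set.ncard_image_le (Set.toFinite _)) h) (Set.toFinite _)
  have := hinj (Set.mem_image_of_mem _ hx) (Set.mem_image_of_mem _ hy)
    (funext fun c => hxy c c.2)
  exact congrFun this ⟨b, hb⟩

lemma ncard_image_add_le {S T : Type*} {f : S → T} {s : Set S} (hs : s.Finite) {q : Set T}
    (hq : ∀ t ∈ q, ∃ a ∈ s, ∃ b ∈ s, f a = t ∧ f b = t ∧ a ≠ b) :
    (f '' s).ncard + q.ncard ≤ s.ncard := by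
  obtain rfl | ⟨a₀, -⟩ := s.eq_empty_or_nonempty
  · obtain rfl : q = ∅ := Set.eq_empty_of_forall_notMem fun t ht => by simpa using hq t ht
    simp
  have : Nonempty S := ⟨a₀⟩
  have hg : ∀ t ∈ f '' s, ∃ a ∈ s, f a = t := fun t ht => ht
  choose! g hgs hfg using hg
  have hg' : ∀ t ∈ q, ∃ b ∈ s, f b = t ∧ b ≠ g t := by
    intro t ht
    obtain ⟨a, ha, b, hb, h1, h2, h3⟩ := hq t ht
    by_cases h : a = g t
    · exact ⟨b, hb, h2, fun h' => h3 (h.trans h'.symm)⟩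
    · exact ⟨a, ha, h1, h⟩
  choose! g' hgs' hfg' hne using hg'
  have hinj : Set.InjOn g (f '' s) := fun a ha b hb h => by rw [← hfg a ha, ← hfg b hb, h]
  have hinj' : Set.InjOn g' q := fun a ha b hb h => by rw [← hfg' a ha, ← hfg' b hb, h]
  have hsub : g '' (f '' s) ⊆ s := Set.image_subset_iff.2 hgs
  have hsub' : Set.image g' q ⊆ s := Set.image_subset_iff.2 hgs'
  rw [← hinj.ncard_image, ← hinj'.ncard_image,
    ← Set.ncard_union_eq ?_ (hs.subset hsub) (hs.subset hsub')]
  · exact Set.ncard_le_ncard (Set.union_subset hsub hsub') hs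
  · rw [Set.disjoint_left]
    rintro _ ⟨t, ht, rfl⟩ ⟨t', ht', h⟩
    have : t' = t := by rw [← hfg t ht, ← h, hfg' t' ht']
    subst this
    exact hne _ ht' h

lemma complexity_add_ncard_ambiguousPatterns_le {A : Type*} [Finite A] (X : Set (ℤ × ℤ → A))
    {B C : Finset (ℤ × ℤ)} (hCB : C ⊆ B) {w : ℕ} (hB : ∀ i : ℤ, 0 ≤ i → i ≤ w → (i, 0) ∈ B) :
    complexity X C + (ambiguousPatterns X C w).ncard ≤ complexity X B := by
  unfold complexity
  rw [← image_restrict X hCB]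
  refine ncard_image_add_le (Set.toFinite _) ?_
  rintro _ ⟨x, hx, y, hy, hxy, ⟨i, h0, h1, hne⟩, rfl⟩
  refine ⟨_, Set.mem_image_of_mem _ hx, _, Set.mem_image_of_mem _ hy, rfl, ?_, ?_⟩
  · exact funext fun c => (hxy c c.2).symm
  · exact fun h => hne (congrFun h ⟨_, hB i h0 h1⟩)

end Complexity

section Convexity

/-- Finite subsets of `ℤ²` containing all lattice points of the quadrangles they span. -/
def DiscreteConvex (B : Finset (ℤ × ℤ)) : Prop :=
  ∀ p₁ ∈ B, ∀ p₂ ∈ B, ∀ p₃ ∈ B, ∀ p₄ ∈ B, ∀ a₁ a₂ a₃ a₄ : ℤ, 0 ≤ a₁ → 0 ≤ a₂ → 0 ≤ a₃ → 0 ≤ a₄ →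
    0 < a₁ + a₂ + a₃ + a₄ → ∀ q : ℤ × ℤ,
    (a₁ + a₂ + a₃ + a₄) • q = a₁ • p₁ + a₂ • p₂ + a₃ • p₃ + a₄ • p₄ → q ∈ B

lemma DiscreteConvex.filter_le {B : Finset (ℤ × ℤ)} (hB : DiscreteConvex B) (f : ℤ × ℤ →+ ℤ)
    (M : ℤ) : DiscreteConvex (B.filter fun p => f p ≤ M) := by
  intro p₁ h₁ p₂ h₂ p₃ h₃ p₄ h₄ a₁ a₂ a₃ a₄ ha₁ ha₂ ha₃ ha₄ hpos q hq
  rw [Finset.mem_filter] at *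
  refine ⟨hB p₁ h₁.1 p₂ h₂.1 p₃ h₃.1 p₄ h₄.1 a₁ a₂ a₃ a₄ ha₁ ha₂ ha₃ ha₄ hpos q hq, ?_⟩
  have := congrArg f hq
  simp only [map_add, map_zsmul, smul_eq_mul] at this
  have e₁ := mul_le_mul_of_nonneg_left h₁.2 ha₁
  have e₂ := mul_le_mul_of_nonneg_left h₂.2 ha₂
  have e₃ := mul_le_mul_of_nonneg_left h₃.2 ha₃
  have e₄ := mul_le_mul_of_nonneg_left h₄.2 ha₄
  refine le_of_mul_le_mul_left ?_ hpos
  linarith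

/-- The linear functional `(i, j) ↦ a * i + b * j`. -/
def intFunctional (a b : ℤ) : ℤ × ℤ →+ ℤ where
  toFun n := a * n.1 + b * n.2
  map_zero' := by simp
  map_add' m n := by
    simp only [Prod.fst_add, Prod.snd_add]
    ring

lemma intFunctional_apply (a b : ℤ) (n : ℤ × ℤ) : intFunctional a b n = a * n.1 + b * n.2 := rfl

lemma DiscreteConvex.mem_row {B : Finset (ℤ × ℤ)} (hB : DiscreteConvex B) {a b h i : ℤ}
    (ha : (a, h) ∈ B) (hb : (b, h) ∈ B) (h1 : a ≤ i) (h2 : i ≤ b) : (i, h) ∈ B := by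
  rcases eq_or_lt_of_le (h1.trans h2) with hab | hab
  · rwa [show i = a by omega]
  · refine hB _ ha _ hb _ ha _ hb (b - i) (i - a) 0 0 (by omega) (by omega) le_rfl le_rfl
      (by omega) _ ?_
    ext
    · simp only [Prod.smul_fst, Prod.fst_add, smul_eq_mul]
      ring
    · simp only [Prod.smul_snd, Prod.snd_add, smul_eq_mul]
      ring

lemma DiscreteConvex.exists_row {B : Finset (ℤ × ℤ)} (hB : DiscreteConvex B) {w a : ℤ} {H : ℕ}
    (h1 : (0, 0) ∈ B) (h2 : (w, 0) ∈ B) (h3 : (a, -(H : ℤ)) ∈ B) (h4 : (a + w, -(H : ℤ)) ∈ B)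
    {r : ℤ} (hr : -(H : ℤ) ≤ r) (hr' : r < 0) :
    ∃ o : ℤ, ∀ i : ℤ, 0 ≤ i → i < w → (o + i, r) ∈ B := by
  have hH : (0 : ℤ) < H := by omega
  refine ⟨-(a * r / H), fun i hi hiw => ?_⟩
  set e := H * (-(a * r / H) + i) + a * r with he
  have hmod := Int.emod_add_mul_ediv (a * r) H
  have hlo := Int.emod_nonneg (a * r) hH.ne'
  have hhi := Int.emod_lt_of_pos (a * r) hH
  have he' : e = a * r % H + H * i := by rw [he]; linarith
  have he0 : 0 ≤ e := by rw [he']; positivity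
  have hew : e ≤ w * H := by
    have : H * i ≤ H * (w - 1) := mul_le_mul_of_nonneg_left (by omega) hH.le
    rw [he']
    linarith
  have hw : 0 < w := by omega
  refine hB _ h1 _ h2 _ h3 _ h4 ((r + H) * (w * H - e)) ((r + H) * e) (-r * (w * H - e)) (-r * e)
    (mul_nonneg (by omega) (by omega)) (mul_nonneg (by omega) he0)
    (mul_nonneg (by omega) (by omega)) (mul_nonneg (by omega) he0) ?_ _ ?_
  · have : (r + H) * (w * H - e) + (r + H) * e + -r * (w * H - e) + -r * e = w * H * H := by ring
    rw [this]
    positivity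
  · ext
    · simp only [Prod.smul_fst, Prod.fst_add, smul_eq_mul]
      rw [he]
      ring
    · simp only [Prod.smul_snd, Prod.snd_add, smul_eq_mul]
      ring

/-- Removing an extremal point of the top row preserves convexity. -/
lemma DiscreteConvex.erase_of_top {B : Finset (ℤ × ℤ)} (hB : DiscreteConvex B) {p : ℤ × ℤ}
    (s : ℤ) (hs : s ≠ 0) (htop : ∀ q ∈ B, q.2 ≤ p.2)
    (hext : ∀ q ∈ B, q.2 = p.2 → s * q.1 ≤ s * p.1) : DiscreteConvex (B.erase p) := by
  obtain ⟨K, hK⟩ : ∃ K : ℤ, ∀ q ∈ B, s * q.1 - s * p.1 < K := by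
    obtain ⟨K, hK⟩ := (B.image fun q => s * q.1 - s * p.1).bddAbove
    exact ⟨K + 1, fun q hq => Int.lt_add_one_iff.2 (hK (Finset.mem_image_of_mem _ hq))⟩
  have : B.erase p = B.filter fun q => intFunctional s (max K 1) q ≤ s * p.1 + max K 1 * p.2 - 1 := by
    ext q
    rw [Finset.mem_erase, Finset.mem_filter, intFunctional_apply, and_comm]
    refine and_congr_right fun hq => ?_
    have h1 := hK q hq
    have h2 := htop q hq
    have h3 := le_max_left K 1
    rcases eq_or_lt_of_le h2 with h | h
    · have h4 := hext q hq h
      rw [h]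
      constructor
      · intro hne
        have : s * q.1 ≠ s * p.1 := fun h5 => hne (Prod.ext (mul_left_cancel₀ hs h5) h)
        omega
      · rintro h5 rfl
        omega
    · have h4 : max K 1 * q.2 ≤ max K 1 * (p.2 - 1) :=
        mul_le_mul_of_nonneg_left (by omega) (by omega)
      refine iff_of_true (fun h5 => by rw [h5] at h; omega) ?_
      linarith
  rw [this]
  exact hB.filter_le _ _

end Convexity

section Core

/-- The case of a convex shape with normalized top row which is not longer than the bottom
row. -/
lemma exists_periodic_of_normalized {A : Type*} [Finite A] [TopologicalSpace A]
    [DiscreteTopology A] {X : Set (ℤ × ℤ → A)} (hX : IsSubshift X) {B : Finset (ℤ × ℤ)}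
    (hB : DiscreteConvex B) (hle : complexity X B ≤ B.card)
    (hmin : ∀ B', DiscreteConvex B' → B'.card < B.card → B'.card < complexity X B')
    {H w : ℕ} {a : ℤ} (h1 : (0, 0) ∈ B) (h2 : ((w : ℤ), 0) ∈ B) (h3 : (a, -(H : ℤ)) ∈ B)
    (h4 : (a + w, -(H : ℤ)) ∈ B) (hrange : ∀ p ∈ B, -(H : ℤ) ≤ p.2 ∧ p.2 ≤ 0)
    (htop : ∀ p ∈ B, p.2 = 0 → 0 ≤ p.1 ∧ p.1 ≤ w)
    (hup : ∃ x ∈ X, ∃ y ∈ X, (∀ n : ℤ × ℤ, n.2 < 0 → x n = y n) ∧ x 0 ≠ y 0) :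
    ∃ z ∈ X, ∃ Q : ℤ, Q ≠ 0 ∧ Function.Periodic z (Q, 0) := by
  have herase : ∀ p ∈ B, DiscreteConvex (B.erase p) → ∀ x ∈ X, ∀ y ∈ X,
      (∀ q ∈ B, q ≠ p → x q = y q) → x p = y p := by
    intro p hp hconv x hx y hy hxy
    have hcard := Finset.card_erase_of_mem hp
    have hpos := Finset.card_pos.2 ⟨p, hp⟩
    have := hmin _ hconv (by omega)
    exact eq_of_complexity_le (B.erase_subset p) (by omega) hx hy
      (fun q hq => hxy q (Finset.mem_of_mem_erase hq) (Finset.ne_of_mem_erase hq)) hp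
  have hprop : Propagates X H w := by
    constructor
    · intro x hx y hy J k hstrip hrow
      have := herase _ h2 (hB.erase_of_top 1 one_ne_zero (fun q hq => (hrange q hq).2)
        fun q hq h => by simpa using (htop q hq h).2) _ (hX.shift_mem x hx (k, J)) _
        (hX.shift_mem y hy (k, J)) fun q hq hne => ?_
      · simpa [add_comm] using this
      · obtain ⟨h5, h6⟩ := hrange q hq
        rcases lt_or_eq_of_le h6 with h7 | h7
        · refine hstrip _ ?_ ?_ <;> simp only [Prod.snd_add] <;> omega
        · obtain ⟨h8, h9⟩ := htop q hq h7
          have h10 : q.1 ≠ w := fun h => hne (Prod.ext h h7)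
          have := hrow q.1 h8 (by omega)
          simpa [Prod.add_def, h7, add_comm] using this
    · intro x hx y hy J k hstrip hrow
      have := herase _ h1 (hB.erase_of_top (-1) (by simp) (fun q hq => (hrange q hq).2)
        fun q hq h => by simpa using (htop q hq h).1) _ (hX.shift_mem x hx (k - 1, J)) _
        (hX.shift_mem y hy (k - 1, J)) fun q hq hne => ?_
      · simpa [add_comm] using this
      · obtain ⟨h5, h6⟩ := hrange q hq
        rcases lt_or_eq_of_le h6 with h7 | h7
        · refine hstrip _ ?_ ?_ <;> simp only [Prod.snd_add] <;> omega
        · obtain ⟨h8, h9⟩ := htop q hq h7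
          have h10 : q.1 ≠ 0 := fun h => hne (Prod.ext h h7)
          have := hrow (q.1 - 1) (by omega) (by omega)
          simp only [Prod.add_def, h7, zero_add]
          rwa [show q.1 + (k - 1) = k + (q.1 - 1) by ring]
  have hC : DiscreteConvex (B.filter fun p => intFunctional 0 1 p ≤ -1) := hB.filter_le _ _
  have hmemC : ∀ p, p ∈ (B.filter fun p => intFunctional 0 1 p ≤ -1) ↔ p ∈ B ∧ p.2 < 0 := by
    intro p
    simp only [Finset.mem_filter, intFunctional_apply, zero_mul, one_mul, zero_add,
      and_congr_right_iff]
    intro _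
    omega
  set C := B.filter fun p => intFunctional 0 1 p ≤ -1 with hCdef
  have hCB : C ⊆ B := Finset.filter_subset _ _
  refine hprop.exists_periodic hX (C := C) (fun n hn => ?_) (fun r hr hr' => ?_) ?_ hup
  · rw [hmemC] at hn
    exact ⟨(hrange n hn.1).1, hn.2⟩
  · obtain ⟨o, ho⟩ := hB.exists_row h1 h2 h3 h4 hr hr'
    exact ⟨o, fun i h5 h6 => (hmemC _).2 ⟨ho i h5 h6, hr'⟩⟩
  · have h5 := complexity_add_ncard_ambiguousPatterns_le X hCB (w := w)
      fun i h5 h6 => hB.mem_row h1 h2 h5 h6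
    have h6 := hmin C hC (Finset.card_lt_card ⟨hCB, fun h => by
      have := ((hmemC _).1 (h h1)).2
      simp at this⟩)
    have h7 : (B \ C).card ≤ w + 1 := by
      have hsub : B \ C ⊆ (Finset.Icc (0 : ℤ) w).image fun i => (i, (0 : ℤ)) := by
        intro p hp
        rw [Finset.mem_sdiff, hmemC] at hp
        have h8 : p.2 = 0 := by
          have := (hrange p hp.1).2
          by_contra h
          exact hp.2 ⟨hp.1, by omega⟩
        exact Finset.mem_image.2 ⟨p.1, Finset.mem_Icc.2 (htop p hp.1 h8), Prod.ext rfl h8.symm⟩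
      refine (Finset.card_le_card hsub).trans (Finset.card_image_le.trans ?_)
      simp
    have h8 := Finset.card_sdiff_add_card_eq_card hCB
    omega

end Core

section Transport

/-- The image of a set of configurations under a change of coordinates. -/
def pull {A : Type*} (φ : ℤ × ℤ ≃+ ℤ × ℤ) (X : Set (ℤ × ℤ → A)) : Set (ℤ × ℤ → A) :=
  {x | x ∘ φ.symm ∈ X}

lemma comp_mem_pull {A : Type*} {φ : ℤ × ℤ ≃+ ℤ × ℤ} {X : Set (ℤ × ℤ → A)} {x : ℤ × ℤ → A}
    (hx : x ∈ X) : x ∘ φ ∈ pull φ X := by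
  have : (x ∘ φ) ∘ φ.symm = x := by
    ext n
    simp
  unfold pull
  rwa [Set.mem_ofPred_eq, this]

lemma pull_pull_symm {A : Type*} (φ : ℤ × ℤ ≃+ ℤ × ℤ) (X : Set (ℤ × ℤ → A)) :
    pull φ (pull φ.symm X) = X := by
  ext x
  have : (x ∘ φ.symm) ∘ φ.symm.symm = x := by
    ext n
    simp
  unfold pull
  rw [Set.mem_ofPred_eq, Set.mem_ofPred_eq, this]

lemma IsSubshift.pull {A : Type*} [TopologicalSpace A] {X : Set (ℤ × ℤ → A)} (hX : IsSubshift X)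
    (φ : ℤ × ℤ ≃+ ℤ × ℤ) : IsSubshift (pull φ X) where
  nonempty := hX.nonempty.imp' (fun x => x ∘ φ) fun _ => comp_mem_pull
  isClosed := hX.isClosed.preimage (continuous_pi fun n => continuous_apply (φ.symm n))
  shift_mem x hx t := by
    have := hX.shift_mem _ hx (φ t)
    simpa [LowComplexity.pull, Function.comp_def] using this

lemma IsMinimalSubshift.pull {A : Type*} [TopologicalSpace A] {X : Set (ℤ × ℤ → A)}
    (hX : IsMinimalSubshift X) (φ : ℤ × ℤ ≃+ ℤ × ℤ) : IsMinimalSubshift (pull φ X) where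
  toIsSubshift := hX.toIsSubshift.pull φ
  eq_of_subset Y hYX hY := by
    have hsub : LowComplexity.pull φ.symm Y ⊆ X := fun x hx => by
      have := hYX hx
      rw [← pull_pull_symm φ.symm X]
      exact this
    rw [← hX.eq_of_subset _ hsub (hY.pull φ.symm), pull_pull_symm]

lemma complexity_image {A : Type*} {X X' : Set (ℤ × ℤ → A)} (ψ : ℤ × ℤ ≃ ℤ × ℤ)
    (h : ∀ x, x ∈ X' ↔ x ∘ ψ.symm ∈ X) (B : Finset (ℤ × ℤ)) :
    complexity X (B.image ψ) = complexity X' B := by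
  have hinj : Function.Injective fun (p : B.image ψ → A) (b : B) =>
      p ⟨ψ b, Finset.mem_image_of_mem _ b.2⟩ := by
    intro p p' hp
    funext ⟨q, hq⟩
    obtain ⟨b, hb, rfl⟩ := Finset.mem_image.1 hq
    exact congrFun hp ⟨b, hb⟩
  unfold complexity
  rw [← Set.ncard_image_of_injective _ hinj, Set.image_image]
  congr 1
  ext p
  constructor
  · rintro ⟨x, hx, rfl⟩
    refine ⟨x ∘ ψ, (h _).2 ?_, rfl⟩
    convert hx using 1
    ext n
    simp
  · rintro ⟨x, hx, rfl⟩
    refine ⟨x ∘ ψ.symm, (h _).1 hx, ?_⟩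
    funext b
    simp

lemma complexity_pull {A : Type*} {X : Set (ℤ × ℤ → A)} (φ : ℤ × ℤ ≃+ ℤ × ℤ)
    (B : Finset (ℤ × ℤ)) : complexity X (B.image φ) = complexity (pull φ X) B :=
  complexity_image φ.toEquiv (fun _ => Iff.rfl) B

lemma complexity_translate {A : Type*} [TopologicalSpace A] {X : Set (ℤ × ℤ → A)}
    (hX : IsSubshift X) (t : ℤ × ℤ) (B : Finset (ℤ × ℤ)) :
    complexity X (B.image (Equiv.addRight t)) = complexity X B := by
  refine complexity_image (Equiv.addRight t) (fun x => ⟨fun hx => ?_, fun hx => ?_⟩) B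
  · exact hX.shift_mem x hx (-t)
  · have := hX.shift_mem _ hx t
    simpa [Function.comp_def] using this

lemma DiscreteConvex.image {B : Finset (ℤ × ℤ)} (hB : DiscreteConvex B) (φ : ℤ × ℤ ≃+ ℤ × ℤ) :
    DiscreteConvex (B.image φ) := by
  have hmem : ∀ p, p ∈ B.image φ ↔ φ.symm p ∈ B := by
    intro p
    rw [Finset.mem_image]
    exact ⟨by rintro ⟨b, hb, rfl⟩; simpa using hb, fun h => ⟨_, h, by simp⟩⟩
  intro p₁ h₁ p₂ h₂ p₃ h₃ p₄ h₄ a₁ a₂ a₃ a₄ ha₁ ha₂ ha₃ ha₄ hpos q hq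
  rw [hmem] at *
  refine hB _ h₁ _ h₂ _ h₃ _ h₄ a₁ a₂ a₃ a₄ ha₁ ha₂ ha₃ ha₄ hpos _ ?_
  simpa only [map_add, map_zsmul] using congrArg φ.symm hq

lemma DiscreteConvex.translate {B : Finset (ℤ × ℤ)} (hB : DiscreteConvex B) (t : ℤ × ℤ) :
    DiscreteConvex (B.image (Equiv.addRight t)) := by
  have hmem : ∀ p, p ∈ B.image (Equiv.addRight t) ↔ p - t ∈ B := by
    intro p
    rw [Finset.mem_image]
    exact ⟨by rintro ⟨b, hb, rfl⟩; simpa using hb, fun h => ⟨_, h, by simp⟩⟩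
  intro p₁ h₁ p₂ h₂ p₃ h₃ p₄ h₄ a₁ a₂ a₃ a₄ ha₁ ha₂ ha₃ ha₄ hpos q hq
  rw [hmem] at *
  refine hB _ h₁ _ h₂ _ h₃ _ h₄ a₁ a₂ a₃ a₄ ha₁ ha₂ ha₃ ha₄ hpos _ ?_
  rw [smul_sub, hq]
  module

lemma exists_minimal_convex {A : Type*} {X : Set (ℤ × ℤ → A)} {B : Finset (ℤ × ℤ)}
    (hB : DiscreteConvex B) (hle : complexity X B ≤ B.card) :
    ∃ B : Finset (ℤ × ℤ), DiscreteConvex B ∧ complexity X B ≤ B.card ∧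
      ∀ B', DiscreteConvex B' → B'.card < B.card → B'.card < complexity X B' := by
  classical
  have hex : ∃ k, ∃ B : Finset (ℤ × ℤ), B.card = k ∧ DiscreteConvex B ∧ complexity X B ≤ B.card :=
    ⟨_, B, rfl, hB, hle⟩
  obtain ⟨B, hk, hB, hle⟩ := Nat.find_spec hex
  refine ⟨B, hB, hle, fun B' hB' hlt => ?_⟩
  rw [hk] at hlt
  by_contra hcon
  exact Nat.find_min hex hlt ⟨B', rfl, hB', not_lt.1 hcon⟩

lemma exists_row_ends {B : Finset (ℤ × ℤ)} {p : ℤ × ℤ} (hp : p ∈ B) :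
    ∃ a b : ℤ, (a, p.2) ∈ B ∧ (b, p.2) ∈ B ∧ ∀ q ∈ B, q.2 = p.2 → a ≤ q.1 ∧ q.1 ≤ b := by
  have hne : (B.filter fun q => q.2 = p.2).Nonempty := ⟨p, by simp [hp]⟩
  obtain ⟨l, hl, hlmin⟩ := Finset.exists_min_image _ Prod.fst hne
  obtain ⟨r, hr, hrmax⟩ := Finset.exists_max_image _ Prod.fst hne
  simp only [Finset.mem_filter] at hl hr hlmin hrmax
  refine ⟨l.1, r.1, ?_, ?_, fun q hq h => ⟨hlmin q ⟨hq, h⟩, hrmax q ⟨hq, h⟩⟩⟩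
  · rw [← hl.2]
    exact hl.1
  · rw [← hr.2]
    exact hr.1

lemma exists_periodic_of_top_le_bottom {A : Type*} [Finite A] [TopologicalSpace A]
    [DiscreteTopology A] {X : Set (ℤ × ℤ → A)} (hX : IsSubshift X) {B : Finset (ℤ × ℤ)}
    (hB : DiscreteConvex B) (hle : complexity X B ≤ B.card)
    (hmin : ∀ B', DiscreteConvex B' → B'.card < B.card → B'.card < complexity X B')
    {a b a' b' h l : ℤ} (h1 : (a, h) ∈ B) (h2 : (b, h) ∈ B) (h3 : (a', l) ∈ B) (h4 : (b', l) ∈ B)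
    (hrange : ∀ p ∈ B, l ≤ p.2 ∧ p.2 ≤ h) (htop : ∀ p ∈ B, p.2 = h → a ≤ p.1 ∧ p.1 ≤ b)
    (hab : b - a ≤ b' - a')
    (hup : ∃ x ∈ X, ∃ y ∈ X, (∀ n : ℤ × ℤ, n.2 < 0 → x n = y n) ∧ x 0 ≠ y 0) :
    ∃ z ∈ X, ∃ Q : ℤ, Q ≠ 0 ∧ Function.Periodic z (Q, 0) := by
  have hmem : ∀ p, p ∈ B.image (Equiv.addRight ((-a, -h) : ℤ × ℤ)) ↔ p + (a, h) ∈ B := by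
    intro p
    rw [Finset.mem_image]
    exact ⟨by rintro ⟨b, hb, rfl⟩; simpa [Prod.add_def] using hb,
      fun h => ⟨_, h, by simp [Prod.add_def]⟩⟩
  have hcard : (B.image (Equiv.addRight ((-a, -h) : ℤ × ℤ))).card = B.card :=
    Finset.card_image_of_injective _ (Equiv.injective _)
  have hba : a ≤ b := (htop _ h1 rfl).2
  have hlh : l ≤ h := (hrange _ h1).1
  refine exists_periodic_of_normalized hX (hB.translate (-a, -h)) (H := (h - l).toNat)
    (w := (b - a).toNat) (a := a' - a) ?_ ?_ ?_ ?_ ?_ ?_ ?_ ?_ hup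
  · rw [complexity_translate hX, hcard]
    exact hle
  · rw [hcard]
    exact hmin
  · rw [hmem]
    simpa using h1
  · rw [hmem, Int.toNat_of_nonneg (by omega)]
    simpa using h2
  · rw [hmem, Int.toNat_of_nonneg (by omega)]
    simpa using h3
  · rw [hmem, Int.toNat_of_nonneg (by omega), Int.toNat_of_nonneg (by omega), Prod.mk_add_mk,
      show -(h - l) + h = l by ring]
    exact hB.mem_row h3 h4 (by omega) (by omega)
  · intro p hp
    rw [hmem] at hp
    have := hrange _ hp
    simp only [Prod.snd_add] at this
    omega
  · intro p hp hp0
    rw [hmem] at hp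
    have := htop _ hp (by simp [hp0])
    simp only [Prod.fst_add] at this
    omega

/-- A two-sided non-deterministic subshift of low complexity contains a horizontally periodic
point. -/
lemma exists_periodic_of_convex {A : Type*} [Finite A] [TopologicalSpace A]
    [DiscreteTopology A] {X : Set (ℤ × ℤ → A)} (hX : IsSubshift X) {B : Finset (ℤ × ℤ)}
    (hB : DiscreteConvex B) (hle : complexity X B ≤ B.card)
    (hup : ∃ x ∈ X, ∃ y ∈ X, (∀ n : ℤ × ℤ, n.2 < 0 → x n = y n) ∧ x 0 ≠ y 0)
    (hdown : ∃ x ∈ X, ∃ y ∈ X, (∀ n : ℤ × ℤ, 0 < n.2 → x n = y n) ∧ x 0 ≠ y 0) :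
    ∃ z ∈ X, ∃ Q : ℤ, Q ≠ 0 ∧ Function.Periodic z (Q, 0) := by
  obtain ⟨B, hB, hle, hmin⟩ := exists_minimal_convex hB hle
  have hne : B.Nonempty := by
    have h1 : 0 < complexity X B := (Set.ncard_pos (Set.toFinite _)).2 (hX.nonempty.image _)
    exact Finset.card_pos.1 (by omega)
  obtain ⟨u, hu, humax⟩ := Finset.exists_max_image B Prod.snd hne
  obtain ⟨d, hd, hdmin⟩ := Finset.exists_min_image B Prod.snd hne
  obtain ⟨a, b, ha, hb, hab⟩ := exists_row_ends hu
  obtain ⟨a', b', ha', hb', hab'⟩ := exists_row_ends hd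
  rcases le_total (b - a) (b' - a') with h | h
  · exact exists_periodic_of_top_le_bottom hX hB hle hmin ha hb ha' hb'
      (fun p hp => ⟨hdmin p hp, humax p hp⟩) hab h hup
  · set φ := AddEquiv.neg (ℤ × ℤ) with hφ
    have hmem : ∀ p, p ∈ B.image φ ↔ -p ∈ B := by
      intro p
      rw [Finset.mem_image]
      exact ⟨by rintro ⟨b, hb, rfl⟩; simpa [hφ] using hb, fun h => ⟨_, h, by simp [hφ]⟩⟩
    have hcard : ∀ C : Finset (ℤ × ℤ), (C.image φ).card = C.card := fun C =>
      Finset.card_image_of_injective _ φ.injective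
    have himage : (B.image φ).image φ = B := by
      rw [Finset.image_image, show φ ∘ φ = id from funext fun p => neg_neg p, Finset.image_id]
    obtain ⟨z, hz, Q, hQ, hper⟩ := exists_periodic_of_top_le_bottom (hX.pull φ) (hB.image φ)
      (a := -b') (b := -a') (a' := -b) (b' := -a) (h := -d.2) (l := -u.2)
      (by rw [← complexity_pull, himage, hcard]; exact hle)
      (fun C hC hlt => by
        rw [← complexity_pull, ← hcard C]
        rw [hcard B, ← hcard C] at hlt
        exact hmin _ (hC.image φ) hlt)
      ((hmem _).2 (by simpa using hb')) ((hmem _).2 (by simpa using ha'))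
      ((hmem _).2 (by simpa using hb)) ((hmem _).2 (by simpa using ha))
      (fun p hp => by
        have h1 := hdmin _ ((hmem p).1 hp)
        have h2 := humax _ ((hmem p).1 hp)
        simp only [Prod.snd_neg] at h1 h2
        omega)
      (fun p hp h0 => by
        have h1 := hab' _ ((hmem p).1 hp) (by simp [h0])
        simp only [Prod.fst_neg] at h1
        omega)
      (by omega) (by
        obtain ⟨x, hx, y, hy, hxy, h0⟩ := hdown
        refine ⟨_, comp_mem_pull (φ := φ) hx, _, comp_mem_pull (φ := φ) hy, fun n hn => ?_, ?_⟩
        · exact hxy _ (by simpa [hφ] using hn)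
        · simpa using h0)
    refine ⟨_, hz, -Q, neg_ne_zero.2 hQ, fun n => ?_⟩
    have h1 : ∀ p, φ.symm p = -p := fun _ => rfl
    have h2 := hper (-n)
    simp only [Function.comp_apply, h1]
    rwa [neg_add, show -((-Q, 0) : ℤ × ℤ) = (Q, 0) by simp]

end Transport

section Annihilation

lemma diffs_sub (T : List (ℤ × ℤ)) (e f : ℤ × ℤ → ℤ) :
    diffs T (fun n => e n - f n) = fun n => diffs T e n - diffs T f n := by
  induction T generalizing e f with
  | nil => rfl
  | cons t T ih =>
    simp only [diffs]
    rw [← ih]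
    congr 1
    ext n
    ring

lemma diffs_map_comp (φ : ℤ × ℤ ≃+ ℤ × ℤ) (T : List (ℤ × ℤ)) (e : ℤ × ℤ → ℤ) :
    diffs (T.map φ.symm) (e ∘ φ) = diffs T e ∘ φ := by
  induction T generalizing e with
  | nil => rfl
  | cons t T ih =>
    simp only [diffs, List.map_cons]
    rw [← ih]
    congr 1
    ext n
    simp

/-- Low complexity yields an affine relation between the symbols of a pattern. -/
lemma exists_affine_relation {A : Type*} [Finite A] {X : Set (ℤ × ℤ → A)} (hX : X.Nonempty)
    {B : Finset (ℤ × ℤ)} (hle : complexity X B ≤ B.card) (ν : A → ℤ) :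
    ∃ (g : ℤ × ℤ → ℤ) (g₀ : ℤ), (∃ d ∈ B, g d ≠ 0) ∧
      ∀ x ∈ X, ∑ d ∈ B, g d * ν (x d) = g₀ := by
  classical
  set S := (fun (x : ℤ × ℤ → A) (b : B) => x b) '' X with hS
  have := Fintype.ofFinite S
  let L : (Option B → ℤ) →ₗ[ℤ] S → ℤ :=
    { toFun := fun u p => u none + ∑ b : B, u (some b) * ν (p.1 b)
      map_add' := fun u v => by
        ext p
        simp only [Pi.add_apply, add_mul, Finset.sum_add_distrib]
        ring
      map_smul' := fun k u => by
        ext p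
        simp only [Pi.smul_apply, smul_eq_mul, mul_assoc, mul_add, Finset.mul_sum,
          RingHom.id_apply] }
  have hninj : ¬ Function.Injective L := fun hinj => by
    have h1 := card_le_of_injective ℤ L hinj
    rw [Fintype.card_option, Fintype.card_coe, ← Nat.card_eq_fintype_card] at h1
    have h2 : Nat.card S ≤ B.card := hle
    omega
  rw [← LinearMap.ker_eq_bot, Submodule.eq_bot_iff] at hninj
  push Not at hninj
  obtain ⟨u, hu, hu0⟩ := hninj
  have hLu : ∀ x ∈ X, u none + ∑ b : B, u (some b) * ν (x b) = 0 := fun x hx =>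
    congrFun (LinearMap.mem_ker.1 hu) ⟨_, Set.mem_image_of_mem _ hx⟩
  refine ⟨fun d => if h : d ∈ B then u (some ⟨d, h⟩) else 0, -u none, ?_, fun x hx => ?_⟩
  · by_contra! hcon
    have hsome : ∀ b : B, u (some b) = 0 := fun b => by simpa [b.2] using hcon b b.2
    obtain ⟨x, hx⟩ := hX
    have h1 := hLu x hx
    simp only [hsome, zero_mul, Finset.sum_const_zero, add_zero] at h1
    exact hu0 (funext fun o => by cases o with
      | none => exact h1
      | some b => exact hsome b)
  · have h1 := hLu x hx
    rw [← Finset.sum_coe_sort B]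
    simp only [Finset.coe_mem, dite_true]
    linarith

/-- Low complexity yields a product of difference operators annihilating all points. -/
lemma exists_annihilator {A : Type*} [Finite A] [TopologicalSpace A] {X : Set (ℤ × ℤ → A)}
    (hX : IsSubshift X) {B : Finset (ℤ × ℤ)} (hle : complexity X B ≤ B.card) {ν : A → ℤ} {M : ℤ}
    (hM : ∀ a b, |ν a - ν b| ≤ M) :
    ∃ T : List (ℤ × ℤ), (∀ t ∈ T, t ≠ 0) ∧ ∀ x ∈ X, diffs T (ν ∘ x) = 0 := by
  obtain ⟨g, g₀, ⟨d, hd, hgd⟩, hg⟩ := exists_affine_relation hX.nonempty hle ν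
  obtain ⟨T, hT, hz⟩ := exists_diffs_eq_zero M hd hgd
  refine ⟨(1, 0) :: T, ?_, fun x hx => hz _ (fun n => hM _ _) fun n => ?_⟩
  · simpa using hT
  · have h1 := hg _ (hX.shift_mem x hx n)
    have h2 := hg _ (hX.shift_mem x hx (n + (1, 0)))
    simp only [Function.comp_apply, mul_sub, Finset.sum_sub_distrib]
    rw [sub_eq_zero]
    convert h2.trans h1.symm using 5 with d _ d _
    · ring
    · ring

/-- A linear functional with an integral zero depends on one coordinate only, after a suitable
change of coordinates. -/
lemma exists_addEquiv {α β : ℝ} (hαβ : α ≠ 0 ∨ β ≠ 0) {t : ℤ × ℤ} (ht : t ≠ 0)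
    (h : functional α β t = 0) :
    ∃ (φ : ℤ × ℤ ≃+ ℤ × ℤ) (c : ℝ), 0 < c ∧ ∀ n, functional α β (φ n) = c * n.2 := by
  obtain ⟨p, q, r, s, hdet, hpq⟩ : ∃ p q r s : ℤ, p * s + q * r = 1 ∧ α * p + β * q = 0 := by
    have hg : 0 < Int.gcd t.1 t.2 := by
      rw [Int.gcd_pos_iff]
      by_contra! hcon
      exact ht (Prod.ext hcon.1 hcon.2)
    obtain ⟨p, q, hcop, h1, h2⟩ := Int.exists_gcd_one hg
    obtain ⟨s, r, hsr⟩ := Int.isCoprime_iff_gcd_eq_one.2 hcop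
    refine ⟨p, q, r, s, by linarith, ?_⟩
    have h3 : α * (t.1 : ℝ) + β * t.2 = 0 := h
    have h4 : ((Int.gcd t.1 t.2 : ℕ) : ℝ) ≠ 0 := by positivity
    have h1' : (t.1 : ℝ) = p * (Int.gcd t.1 t.2 : ℕ) := by exact_mod_cast h1
    have h2' : (t.2 : ℝ) = q * (Int.gcd t.1 t.2 : ℕ) := by exact_mod_cast h2
    rw [h1', h2'] at h3
    have h5 : (α * p + β * q) * ((Int.gcd t.1 t.2 : ℕ) : ℝ) = 0 := by linear_combination h3
    exact (mul_eq_zero.1 h5).resolve_right h4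
  have hdet' : (p : ℝ) * s + q * r = 1 := by exact_mod_cast hdet
  have hc : -α * r + β * s ≠ 0 := by
    intro h0
    have h1 : β = 0 := by linear_combination p * h0 + r * hpq - β * hdet'
    have h2 : α = 0 := by linear_combination s * hpq - q * h0 - α * hdet'
    exact hαβ.elim (fun h => h h2) fun h => h h1
  obtain ⟨ε, hε, hpos⟩ : ∃ ε : ℤ, ε * ε = 1 ∧ 0 < (-α * r + β * s) * ε := by
    rcases lt_or_gt_of_ne hc with h | h
    · exact ⟨-1, by norm_num, by push_cast; linarith⟩
    · exact ⟨1, by norm_num, by push_cast; linarith⟩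
  refine ⟨{ toFun := fun n => (n.1 * p - ε * n.2 * r, n.1 * q + ε * n.2 * s)
            invFun := fun n => (s * n.1 + r * n.2, ε * (-q * n.1 + p * n.2))
            left_inv := fun n => ?_
            right_inv := fun n => ?_
            map_add' := fun m n => ?_ }, _, hpos, fun n => ?_⟩
  · ext
    · simp only
      linear_combination n.1 * hdet
    · simp only
      linear_combination ε * ε * n.2 * hdet + n.2 * hε
  · ext
    · simp only
      linear_combination n.1 * hdet - (-q * n.1 + p * n.2) * r * hε
    · simp only
      linear_combination n.2 * hdet + (-q * n.1 + p * n.2) * s * hε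
  · ext <;> simp only [Prod.fst_add, Prod.snd_add] <;> ring
  · change α * ((n.1 * p - ε * n.2 * r : ℤ) : ℝ) + β * ((n.1 * q + ε * n.2 * s : ℤ) : ℝ) = _
    push_cast
    linear_combination (n.1 : ℝ) * hpq

end Annihilation

section Main

/-- Points of a minimal subshift of low complexity with respect to a convex shape are periodic. -/
lemma exists_period_of_complexity_le {A : Type*} [Finite A] [TopologicalSpace A]
    [DiscreteTopology A] {X : Set (ℤ × ℤ → A)} (hX : IsMinimalSubshift X) {B : Finset (ℤ × ℤ)}
    (hB : DiscreteConvex B) (hle : complexity X B ≤ B.card) {c : ℤ × ℤ → A} (hc : c ∈ X) :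
    ∃ t : ℤ × ℤ, t ≠ 0 ∧ Function.Periodic c t := by
  rcases X.finite_or_infinite with hfin | hinf
  · exact exists_period_of_finite hX.toIsSubshift hfin hc
  obtain ⟨ν, hν, M, hM⟩ : ∃ ν : A → ℤ, Function.Injective ν ∧ ∃ M : ℤ, ∀ a b, |ν a - ν b| ≤ M := by
    obtain ⟨k, ⟨e⟩⟩ := Finite.exists_equiv_fin A
    refine ⟨fun a => ((e a : ℕ) : ℤ), fun a b h => e.injective (Fin.ext (by simpa using h)), k,
      fun a b => ?_⟩
    have h1 := (e a).2
    have h2 := (e b).2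
    simp only [abs_le]
    omega
  obtain ⟨T, hT, hann⟩ := exists_annihilator hX.toIsSubshift hle hM
  obtain ⟨α, β, hαβ, x, hx, y, hy, hxy, hne⟩ := exists_nondeterministic hX.toIsSubshift hinf
  obtain ⟨t, htT, ht⟩ : ∃ t ∈ T, functional α β t = 0 := by
    by_contra! hcon
    have h1 : diffs T (fun n => (ν ∘ x) n - (ν ∘ y) n) = 0 := by
      rw [diffs_sub, hann x hx, hann y hy]
      ext n
      simp
    have h2 := eq_zero_of_diffs_of_halfPlane _ hcon (α := 0) (fun n hn => by simp [hxy n hn]) h1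
    exact hne (hν (sub_eq_zero.1 (congrFun h2 0)))
  obtain ⟨φ, κ, hκ, hφ⟩ := exists_addEquiv hαβ (hT t htT) ht
  have hX₁ := hX.pull φ
  have hup : ∃ x ∈ pull φ X, ∃ y ∈ pull φ X, (∀ n : ℤ × ℤ, n.2 < 0 → x n = y n) ∧ x 0 ≠ y 0 := by
    refine ⟨_, comp_mem_pull (φ := φ) hx, _, comp_mem_pull (φ := φ) hy, fun n hn => hxy _ ?_, ?_⟩
    · rw [hφ]
      exact mul_neg_of_pos_of_neg hκ (by exact_mod_cast hn)
    · simpa using hne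
  have hann₁ : ∀ x ∈ pull φ X, diffs (T.map φ.symm) (ν ∘ x) = 0 := by
    intro x hx
    have h1 : ν ∘ x = (ν ∘ x ∘ φ.symm) ∘ φ := by
      ext n
      simp
    rw [h1, diffs_map_comp, hann _ hx]
    rfl
  obtain ⟨P, hP, hPper⟩ := exists_horizontal_period (T.map φ.symm) (by
    intro t ht
    obtain ⟨s, hs, rfl⟩ := List.mem_map.1 ht
    simpa using hT s hs)
  have hdown := exists_nondeterministic_down hX₁ hν (Int.natAbs_ne_zero.2 hP)
    (fun x hx y hy hxy => by
      have h1 : Function.Periodic (fun n => ν (x n) - ν (y n)) (P, 0) := by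
        refine hPper _ 0 M (fun n => hM _ _) (fun n hn => ?_) ?_
        · rw [height_apply] at hn
          rw [hxy n (by exact_mod_cast hn), sub_self]
        · have h2 := diffs_sub (T.map φ.symm) (ν ∘ x) (ν ∘ y)
          rw [hann₁ x hx, hann₁ y hy] at h2
          simp only [Function.comp_apply, Pi.zero_apply, sub_self] at h2
          exact h2
      rcases Int.natAbs_eq P with h2 | h2
      · rwa [h2] at h1
      · have h3 := h1.neg
        rwa [Prod.neg_mk, neg_zero, h2, neg_neg] at h3) hup
  obtain ⟨z, hz, Q, hQ, hzper⟩ := exists_periodic_of_convex hX₁.toIsSubshift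
    (hB.image φ.symm) (by
      rw [← complexity_pull, Finset.image_image, Finset.card_image_of_injective _ φ.symm.injective,
        show φ ∘ φ.symm = id from funext φ.apply_symm_apply, Finset.image_id]
      exact hle) hup hdown
  refine ⟨φ (Q, 0), ?_, hX.periodic hz (fun n => ?_) hc⟩
  · simpa using hQ
  · have := hzper (φ.symm n)
    simpa using this

lemma isMinimalSubshift_orbitClosure {A : Type*} [TopologicalSpace A] {c : ℤ × ℤ → A}
    (hur : UniformlyRecurrent c) : IsMinimalSubshift (orbitClosure c) := by
  have hself : ∀ d : ℤ × ℤ → A, d ∈ orbit d := fun d => ⟨0, by ext n; simp [Translate]⟩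
  refine ⟨⟨⟨c, subset_closure (hself c)⟩, isClosed_closure, fun x hx t => ?_⟩, fun Y hY hYs => ?_⟩
  · have hcont : Continuous fun (x : ℤ × ℤ → A) n => x (n + t) :=
      continuous_pi fun n => continuous_apply _
    refine map_mem_closure hcont hx ?_
    rintro _ ⟨s, rfl⟩
    refine ⟨s - t, ?_⟩
    ext n
    simp only [Translate]
    congr 1
    abel
  · obtain ⟨y, hy⟩ := hYs.nonempty
    refine hY.antisymm ?_
    rw [← hur y (hY hy)]
    refine closure_minimal ?_ hYs.isClosed
    rintro _ ⟨t, rfl⟩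
    exact hYs.shift_mem y hy (-t)

lemma mem_Icc_product_iff (n m : ℕ) (p : ℤ × ℤ) :
    p ∈ Finset.Icc (1 : ℤ) n ×ˢ Finset.Icc (1 : ℤ) m ↔ p ∈ rect n m := by
  simp [rect, and_assoc]

lemma discreteConvex_Icc_product (n m : ℕ) :
    DiscreteConvex (Finset.Icc (1 : ℤ) n ×ˢ Finset.Icc (1 : ℤ) m) := by
  intro p₁ h₁ p₂ h₂ p₃ h₃ p₄ h₄ a₁ a₂ a₃ a₄ ha₁ ha₂ ha₃ ha₄ hpos q hq
  have key : ∀ x₁ x₂ x₃ x₄ y M : ℤ, 1 ≤ x₁ ∧ x₁ ≤ M → 1 ≤ x₂ ∧ x₂ ≤ M → 1 ≤ x₃ ∧ x₃ ≤ M →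
      1 ≤ x₄ ∧ x₄ ≤ M → (a₁ + a₂ + a₃ + a₄) * y = a₁ * x₁ + a₂ * x₂ + a₃ * x₃ + a₄ * x₄ →
      1 ≤ y ∧ y ≤ M := by
    intro x₁ x₂ x₃ x₄ y M k₁ k₂ k₃ k₄ hy
    constructor
    · refine le_of_mul_le_mul_left ?_ hpos
      linarith [mul_le_mul_of_nonneg_left k₁.1 ha₁, mul_le_mul_of_nonneg_left k₂.1 ha₂,
        mul_le_mul_of_nonneg_left k₃.1 ha₃, mul_le_mul_of_nonneg_left k₄.1 ha₄]
    · refine le_of_mul_le_mul_left ?_ hpos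
      linarith [mul_le_mul_of_nonneg_left k₁.2 ha₁, mul_le_mul_of_nonneg_left k₂.2 ha₂,
        mul_le_mul_of_nonneg_left k₃.2 ha₃, mul_le_mul_of_nonneg_left k₄.2 ha₄]
  simp only [Finset.mem_product, Finset.mem_Icc] at *
  exact ⟨key _ _ _ _ _ _ h₁.1 h₂.1 h₃.1 h₄.1 (by simpa using congrArg Prod.fst hq),
    key _ _ _ _ _ _ h₁.2 h₂.2 h₃.2 h₄.2 (by simpa using congrArg Prod.snd hq)⟩

lemma complexity_orbitClosure_le {A : Type*} [Finite A] [TopologicalSpace A] [DiscreteTopology A]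
    (c : ℤ × ℤ → A) {B : Finset (ℤ × ℤ)} {D : Set (ℤ × ℤ)} (hBD : ∀ p, p ∈ B ↔ p ∈ D) :
    complexity (orbitClosure c) B ≤ (patterns c D).ncard := by
  have : Finite D := Set.Finite.subset B.finite_toSet fun p hp => (hBD p).2 hp
  have hinj : Function.Injective fun (p : B → A) (d : D) => p ⟨d, (hBD d).2 d.2⟩ := by
    intro p p' h
    funext b
    exact congrFun h ⟨b, (hBD b).1 b.2⟩
  unfold complexity
  rw [← Set.ncard_image_of_injective _ hinj, Set.image_image]
  refine Set.ncard_le_ncard ?_ (Set.toFinite _)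
  rintro _ ⟨x, hx, rfl⟩
  have hopen : IsOpen {y : ℤ × ℤ → A | ∀ b ∈ B, y b = x b} := by
    have : {y : ℤ × ℤ → A | ∀ b ∈ B, y b = x b} = ⋂ b ∈ B, (fun y => y b) ⁻¹' {x b} := by
      ext y
      simp
    rw [this]
    exact isOpen_biInter_finset fun b _ => (isOpen_discrete _).preimage (continuous_apply b)
  obtain ⟨y, hy, t, rfl⟩ := mem_closure_iff.1 hx _ hopen fun _ _ => rfl
  exact ⟨t, fun d => (hy d ((hBD d).2 d.2)).symm⟩

end Main

end LowComplexity

/-- A uniformly recurrent configuration over a finite alphabet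
that has low complexity with respect to a rectangle is periodic. -/
theorem periodic_of_uniformlyRecurrent_low_complexity
    {A : Type*} [Fintype A] [TopologicalSpace A] [DiscreteTopology A]
    (c : ℤ × ℤ → A) (hur : UniformlyRecurrent c)
    (n m : ℕ) (hn : 1 ≤ n) (hm : 1 ≤ m)
    (hlc : (patterns c (rect n m)).ncard ≤ n * m) :
    Periodic c := by
  have hc : c ∈ orbitClosure c := subset_closure ⟨0, by ext n; simp [Translate]⟩
  obtain ⟨t, ht, hper⟩ := LowComplexity.exists_period_of_complexity_le
    (LowComplexity.isMinimalSubshift_orbitClosure hur) (LowComplexity.discreteConvex_Icc_product n m)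
    ((LowComplexity.complexity_orbitClosure_le c
      (LowComplexity.mem_Icc_product_iff n m)).trans (by simpa using hlc)) hc
  exact ⟨t, ht, funext fun n => hper.sub_eq n⟩
end

section
/- Let c : ℤ² → ℤ be a configuration taking only finitely many values that is annihilated by a non-trivial Laurent polynomial. If u ∈ ℤ² is a one-sided direction of determinism of the orbit closure of c, then there exists a configuration d in the orbit closure of c such that the orbit closure of d is deterministic in both directions u and −u. -/
/-- A Laurent polynomial `f` (a finitely supported `ℤ`-valued function on `ℤ²`)
annihilates the configuration `c` if all the coefficients of the formal product
`f · c` vanish. -/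
def Annihilates (f : (ℤ × ℤ) →₀ ℤ) (c : ℤ × ℤ → ℤ) : Prop :=
  ∀ n : ℤ × ℤ, ∑ t ∈ f.support, f t * c (n - t) = 0

theorem inner2_add (x y u : ℤ × ℤ) : inner2 (x + y) u = inner2 x u + inner2 y u := by
  simp only [inner2, Prod.fst_add, Prod.snd_add]; ring

theorem inner2_sub (x y u : ℤ × ℤ) : inner2 (x - y) u = inner2 x u - inner2 y u := by
  simp only [inner2, Prod.fst_sub, Prod.snd_sub]; ring

theorem inner2_smul (m : ℤ) (x u : ℤ × ℤ) : inner2 (m • x) u = m * inner2 x u := by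
  simp only [inner2, Prod.smul_fst, Prod.smul_snd, smul_eq_mul]; ring

theorem inner2_self_pos {u : ℤ × ℤ} (hu : u ≠ 0) : 0 < inner2 u u := by
  have h : u.1 ≠ 0 ∨ u.2 ≠ 0 := by
    by_contra! h
    exact hu (Prod.ext h.1 h.2)
  unfold inner2
  rcases h with h | h
  · have := mul_self_pos.2 h
    nlinarith [mul_self_nonneg u.2]
  · have := mul_self_pos.2 h
    nlinarith [mul_self_nonneg u.1]

/-- The vector `u` rotated by a right angle. -/
def perp (u : ℤ × ℤ) : ℤ × ℤ := (-u.2, u.1)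

theorem inner2_perp_self (u : ℤ × ℤ) : inner2 (perp u) u = 0 := by
  simp only [inner2, perp]; ring

theorem inner2_perp_perp (u : ℤ × ℤ) : inner2 (perp u) (perp u) = inner2 u u := by
  simp only [inner2, perp]; ring

/-- A solution of a linear recurrence that vanishes on a long enough window vanishes. -/
theorem eq_zero_of_window {α : Type*} (S : Finset α) (hS : S.Nonempty) (w : α → ℤ)
    (hw : ∀ t ∈ S, w t ≠ 0) (j : α → ℤ) (hj : Set.InjOn j S) :
    ∃ L : ℕ, ∀ b : ℤ → ℤ, (∀ i, ∑ t ∈ S, w t * b (i - j t) = 0) →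
      ∀ i, (∀ r : ℤ, i ≤ r → r < i + L → b r = 0) → ∀ r, b r = 0 := by
  obtain ⟨s, hs, hsmax⟩ := S.exists_max_image j hS
  obtain ⟨m, hm, hmmin⟩ := S.exists_min_image j hS
  have hms := hsmax m hm
  refine ⟨(j s - j m).toNat, fun b hb i hi => ?_⟩
  have hL : ((j s - j m).toNat : ℤ) = j s - j m := Int.toNat_of_nonneg (by linarith)
  rw [hL] at hi
  have key : ∀ t₀ ∈ S, ∀ k : ℤ, (∀ t ∈ S, t ≠ t₀ → b (k + j t₀ - j t) = 0) → b k = 0 := by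
    intro t₀ ht₀ k hk
    have h := hb (k + j t₀)
    rw [Finset.sum_eq_single_of_mem t₀ ht₀ (fun t ht hne => by rw [hk t ht hne, mul_zero])] at h
    simpa [hw t₀ ht₀] using h
  have step_up : ∀ i : ℤ, (∀ r : ℤ, i ≤ r → r < i + (j s - j m) → b r = 0) →
      b (i + (j s - j m)) = 0 := by
    intro i hi
    refine key m hm _ fun t ht hne => hi _ ?_ ?_
    · have := hsmax t ht; linarith
    · have := hmmin t ht
      have : j m ≠ j t := fun h => hne (hj ht hm h.symm)
      omega
  have step_down : ∀ i : ℤ, (∀ r : ℤ, i ≤ r → r < i + (j s - j m) → b r = 0) →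
      b (i - 1) = 0 := by
    intro i hi
    refine key s hs _ fun t ht hne => hi _ ?_ ?_
    · have := hsmax t ht
      have : j s ≠ j t := fun h => hne (hj ht hs h.symm)
      omega
    · have := hmmin t ht; linarith
  have all : ∀ k : ℤ, ∀ r : ℤ, k ≤ r → r < k + (j s - j m) → b r = 0 := by
    intro k
    induction k using Int.inductionOn' (b := i) with
    | zero => exact hi
    | succ k _ ih =>
      intro r h1 h2
      by_cases h : r < k + (j s - j m)
      · exact ih r (by omega) h
      · obtain rfl : r = k + (j s - j m) := by omega
        exact step_up k ih
    | pred k _ ih =>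
      intro r h1 h2
      by_cases h : k ≤ r
      · exact ih r h (by omega)
      · obtain rfl : r = k - 1 := by omega
        exact step_down k ih
  intro r
  have := step_up (r - (j s - j m)) (all _)
  rwa [sub_add_cancel] at this

/-- Bounded integer solutions of a linear recurrence have a common period. -/
theorem exists_common_period_int {α : Type*} (S : Finset α) (hS : S.Nonempty) (w : α → ℤ)
    (hw : ∀ t ∈ S, w t ≠ 0) (j : α → ℤ) (hj : Set.InjOn j S) (B : ℤ) :
    ∃ N : ℕ, 0 < N ∧ ∀ a : ℤ → ℤ, (∀ i, |a i| ≤ B) →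
      (∀ i, ∑ t ∈ S, w t * a (i - j t) = 0) → ∀ i (m : ℕ), a (i + m * N) = a i := by
  obtain ⟨L, hL⟩ := eq_zero_of_window S hS w hw j hj
  refine ⟨(Fintype.card (Fin L → Set.Icc (-B) B)).factorial, Nat.factorial_pos _,
    fun a haB ha i m => ?_⟩
  let window : Fin (Fintype.card (Fin L → Set.Icc (-B) B) + 1) → (Fin L → Set.Icc (-B) B) :=
    fun n k => ⟨a ((n : ℤ) + k), abs_le.1 (haB _)⟩
  obtain ⟨n₁, n₂, hne, heq⟩ := Fintype.exists_ne_map_eq_of_card_lt window (by simp)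
  wlog hlt : n₁ < n₂ generalizing n₁ n₂
  · exact this n₂ n₁ hne.symm heq.symm (lt_of_le_of_ne (not_lt.1 hlt) hne.symm)
  have hlt' : (n₁ : ℕ) < n₂ := hlt
  obtain ⟨q, hq⟩ : (n₂ - n₁ : ℕ) ∣ (Fintype.card (Fin L → Set.Icc (-B) B)).factorial :=
    Nat.dvd_factorial (by omega) (by omega)
  have hper : ∀ r, a (r + (n₂ - n₁ : ℕ)) = a r := by
    intro r
    have := hL (fun r => a (r + (n₂ - n₁ : ℕ)) - a r) (fun i => ?_) n₁ (fun r h1 h2 => ?_) r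
    · linarith
    · have h1 := ha i
      have h2 := ha (i + (n₂ - n₁ : ℕ))
      rw [← sub_eq_zero.2 (h2.trans h1.symm), ← Finset.sum_sub_distrib]
      refine Finset.sum_congr rfl fun t _ => ?_
      rw [mul_sub]; congr 3; ring
    · have hr : (r - n₁).toNat < L := by omega
      have h := congrArg Subtype.val (congrFun heq ⟨(r - n₁).toNat, hr⟩)
      simp only [window] at h
      have e1 : (n₁ : ℤ) + ((r - n₁).toNat : ℕ) = r := by omega
      have e2 : (n₂ : ℤ) + ((r - n₁).toNat : ℕ) = r + (n₂ - n₁ : ℕ) := by omega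
      rw [e1, e2] at h
      simp [h]
  have hiter : ∀ k : ℕ, a (i + k * (n₂ - n₁ : ℕ)) = a i := by
    intro k
    induction k with
    | zero => simp
    | succ k ih => rw [← ih, ← hper (i + k * (n₂ - n₁ : ℕ))]; congr 1; push_cast; ring
  rw [← hiter (m * q), hq]
  congr 1; push_cast; ring

theorem eq_zero_of_bounded_linear {M a b : ℤ} (h : ∀ m : ℕ, |a + m * b| ≤ M) : b = 0 := by
  by_contra hb
  have h0 := h 0
  have h1 := h (2 * M + 1).toNat
  have hM : 0 ≤ M := (abs_nonneg _).trans h0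
  rw [Int.toNat_of_nonneg (by linarith)] at h1
  have hb1 : 1 ≤ |b| := Int.one_le_abs hb
  simp only [Nat.cast_zero, zero_mul, add_zero] at h0
  have h2 : |(2 * M + 1) * b| ≤ 2 * M := by
    have := abs_sub (a + (2 * M + 1) * b) a
    rw [add_sub_cancel_left] at this
    linarith
  rw [abs_mul, abs_of_pos (by linarith : (0 : ℤ) < 2 * M + 1)] at h2
  nlinarith

/-- Bounded configurations annihilated by `f` and vanishing on the half plane opposite to
`halfPlane u` have a common period orthogonal to `u`. -/
theorem exists_common_period {f : (ℤ × ℤ) →₀ ℤ} (hf : f ≠ 0) {u : ℤ × ℤ} (hu : u ≠ 0) (M : ℤ) :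
    ∃ N : ℕ, 0 < N ∧ ∀ h : ℤ × ℤ → ℤ, (∀ x, |h x| ≤ M) → Annihilates f h →
      (∀ x, 0 < inner2 x u → h x = 0) → ∀ x, h (x + (N : ℤ) • perp u) = h x := by
  obtain ⟨g, a, b, hab, h1, h2⟩ : ∃ g a b : ℤ, IsCoprime a b ∧ u.1 = g * a ∧ u.2 = g * b := by
    have hg : Int.gcd u.1 u.2 ≠ 0 := by
      rw [Ne, Int.gcd_eq_zero_iff]
      exact fun h => hu (Prod.ext h.1 h.2)
    obtain ⟨a, b, hab, ha, hb⟩ := Int.exists_gcd_one (Nat.pos_of_ne_zero hg)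
    exact ⟨Int.gcd u.1 u.2, a, b, Int.isCoprime_iff_gcd_eq_one.2 hab, by linarith, by linarith⟩
  have hg : g ≠ 0 := by
    rintro rfl
    exact hu (Prod.ext (by simpa using h1) (by simpa using h2))
  wlog hgpos : 0 < g generalizing g a b
  · exact this (-g) (-a) (-b) hab.neg_neg (by linarith) (by linarith) (by simpa using hg)
      (by omega)
  lift g to ℕ using hgpos.le
  obtain ⟨s, r, hsr⟩ := hab
  obtain ⟨t₀, ht₀, hmax⟩ := f.support.exists_max_image (fun t => inner2 t u)
    (Finsupp.support_nonempty_iff.2 hf)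
  set S := f.support.filter fun t => inner2 t u = inner2 t₀ u with hSdef
  let v : ℤ × ℤ := (-b, a)
  have hv : perp u = (g : ℤ) • v := by
    ext <;> simp [perp, v, h1, h2]
  let j : ℤ × ℤ → ℤ := fun t => s * (t.2 - t₀.2) - r * (t.1 - t₀.1)
  have hj : ∀ t ∈ S, t = t₀ + j t • v := by
    intro t ht
    have ht : inner2 t u = inner2 t₀ u := (Finset.mem_filter.1 ht).2
    have h0 : (t.1 - t₀.1) * a + (t.2 - t₀.2) * b = 0 := by
      have : (g : ℤ) * ((t.1 - t₀.1) * a + (t.2 - t₀.2) * b) = 0 := by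
        simp only [inner2, h1, h2] at ht
        linear_combination ht
      exact (mul_eq_zero.1 this).resolve_left hg
    ext
    · simp only [Prod.fst_add, Prod.smul_fst, smul_eq_mul, j, v]
      linear_combination (-(t.1 - t₀.1)) * hsr + s * h0
    · simp only [Prod.snd_add, Prod.smul_snd, smul_eq_mul, j, v]
      linear_combination (-(t.2 - t₀.2)) * hsr + r * h0
  have hjinj : Set.InjOn j S := by
    intro t ht t' ht' h
    rw [hj t ht, hj t' ht', h]
  obtain ⟨N, hN, hper⟩ := exists_common_period_int S ⟨t₀, by simp [S, Finsupp.mem_support_iff.1 ht₀]⟩ f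
    (fun t ht => Finsupp.mem_support_iff.1 (Finset.mem_filter.1 ht).1) j hjinj (2 * M)
  refine ⟨N, hN, fun h hM hann hzero => ?_⟩
  set p : ℤ × ℤ := (N : ℤ) • perp u with hp
  have hpu : inner2 p u = 0 := by rw [hp, inner2_smul, inner2_perp_self, mul_zero]
  have hpv : p = ((g * N : ℕ) : ℤ) • v := by
    rw [hp, hv, smul_smul]; congr 1; push_cast; ring
  have hdiff : ∀ n, ∑ t ∈ f.support, f t * (h (n - t + p) - h (n - t)) = 0 := by
    intro n
    have e1 := hann (n + p)
    have e2 := hann n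
    rw [← sub_eq_zero.2 (e1.trans e2.symm), ← Finset.sum_sub_distrib]
    refine Finset.sum_congr rfl fun t _ => ?_
    rw [mul_sub]; congr 3; abel
  have main : ∀ k : ℕ, ∀ x, -(k : ℤ) < inner2 x u → h (x + p) - h x = 0 := by
    intro k
    induction k with
    | zero =>
      intro x hx
      have hx : 0 < inner2 x u := by simpa using hx
      rw [hzero x hx, hzero (x + p) (by rw [inner2_add, hpu, add_zero]; exact hx), sub_zero]
    | succ k ih =>
      intro x hx
      by_cases hx' : -(k : ℤ) < inner2 x u
      · exact ih x hx'
      have hxk : inner2 x u = -(k : ℤ) := by push_cast at hx; omega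
      have hvu : inner2 v u = 0 := by
        simp only [inner2, v, h1, h2]; ring
      have hline := hper (fun i => h (x + i • v + p) - h (x + i • v)) (fun i => ?_) (fun i => ?_)
      · have hiter : ∀ m : ℕ, h (x + (m : ℤ) • p) = h x + m * (h (x + p) - h x) := by
          intro m
          induction m with
          | zero => simp
          | succ m ihm =>
            have := hline 0 (m * g)
            simp only [zero_smul, add_zero, zero_add] at this
            rw [show (((m * g : ℕ) : ℤ) * N) • v = (m : ℤ) • p by
              rw [hpv, smul_smul]; congr 1; push_cast; ring] at this
            rw [show x + ((m + 1 : ℕ) : ℤ) • p = x + (m : ℤ) • p + p by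
              rw [Nat.cast_succ, add_smul, one_smul, add_assoc]]
            push_cast
            linarith
        refine eq_zero_of_bounded_linear (M := M) (a := h x) fun m => ?_
        rw [← hiter m]
        exact hM _
      · have := abs_sub (h (x + i • v + p)) (h (x + i • v))
        have := hM (x + i • v + p)
        have := hM (x + i • v)
        linarith
      · rw [← hdiff (x + i • v + t₀), hSdef, Finset.sum_filter]
        refine Finset.sum_congr rfl fun t ht => ?_
        split_ifs with htu
        · have e : x + (i - j t) • v = x + i • v + t₀ - t := by
            conv_rhs => rw [hj t (Finset.mem_filter.2 ⟨ht, htu⟩)]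
            rw [sub_smul]; abel
          rw [e]
        · rw [ih, mul_zero]
          have := hmax t ht
          rw [inner2_sub, inner2_add, inner2_add, inner2_smul, hvu, hxk]
          omega
  intro x
  exact sub_eq_zero.1 (main ((-inner2 x u).toNat + 1) x (by omega))

open Filter Topology

theorem orbitClosure_subset_of_isClosed {c : ℤ × ℤ → ℤ} {K : Set (ℤ × ℤ → ℤ)} (hK : IsClosed K)
    (h : ∀ t, Translate t c ∈ K) : orbitClosure c ⊆ K := by
  refine closure_minimal ?_ hK
  rintro _ ⟨t, rfl⟩
  exact h t

theorem self_mem_orbitClosure (c : ℤ × ℤ → ℤ) : c ∈ orbitClosure c :=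
  subset_closure ⟨0, by funext n; simp [Translate]⟩

theorem translate_mem_orbitClosure {c d : ℤ × ℤ → ℤ} (hd : d ∈ orbitClosure c) (t : ℤ × ℤ) :
    Translate t d ∈ orbitClosure c := by
  have hcont : Continuous (Translate t : (ℤ × ℤ → ℤ) → ℤ × ℤ → ℤ) :=
    continuous_pi fun n => continuous_apply (n - t)
  refine Set.MapsTo.closure ?_ hcont hd
  rintro _ ⟨s, rfl⟩
  exact ⟨t + s, by funext n; simp only [Translate]; congr 1; abel⟩

theorem orbitClosure_subset {c d : ℤ × ℤ → ℤ} (hd : d ∈ orbitClosure c) :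
    orbitClosure d ⊆ orbitClosure c :=
  orbitClosure_subset_of_isClosed isClosed_closure fun t => translate_mem_orbitClosure hd t

theorem mem_range_of_mem_orbitClosure {c d : ℤ × ℤ → ℤ} (hd : d ∈ orbitClosure c) (x : ℤ × ℤ) :
    d x ∈ Set.range c :=
  orbitClosure_subset_of_isClosed (K := {d | d x ∈ Set.range c})
    ((isClosed_discrete (Set.range c)).preimage (continuous_apply x))
    (fun _ => Set.mem_range_self _) hd

theorem annihilates_of_mem_orbitClosure {f : (ℤ × ℤ) →₀ ℤ} {c d : ℤ × ℤ → ℤ}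
    (hann : Annihilates f c) (hd : d ∈ orbitClosure c) : Annihilates f d := by
  intro n
  refine orbitClosure_subset_of_isClosed (K := {d | ∑ t ∈ f.support, f t * d (n - t) = 0})
    (isClosed_eq (continuous_finsetSum _ fun t _ =>
      continuous_const.mul (continuous_apply (n - t))) continuous_const) (fun s => ?_) hd
  rw [Set.mem_ofPred_eq, ← hann (n - s)]
  refine Finset.sum_congr rfl fun t _ => ?_
  simp only [Translate]
  congr 2; abel

/-- Sequences of families in the orbit closure of a finite-valued configuration have pointwise
limits along subsequences. -/
theorem exists_limit {ι : Type*} [Countable ι] {c : ℤ × ℤ → ℤ} (hfin : (Set.range c).Finite)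
    (D : ℕ → ι → ℤ × ℤ → ℤ) (hD : ∀ n i, D n i ∈ orbitClosure c) :
    ∃ L : ι → ℤ × ℤ → ℤ, ∃ φ : ℕ → ℕ, StrictMono φ ∧ (∀ i, L i ∈ orbitClosure c) ∧
      ∀ i x, ∀ᶠ n in atTop, D (φ n) i x = L i x := by
  have hcompact : IsCompact (orbitClosure c) :=
    (isCompact_univ_pi fun _ : ℤ × ℤ => hfin.isCompact).of_isClosed_subset isClosed_closure
      fun d hd x _ => mem_range_of_mem_orbitClosure hd x
  obtain ⟨L, hL, φ, hφ, hlim⟩ :=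
    (isCompact_univ_pi fun _ : ι => hcompact).tendsto_subseq (x := D) fun n i _ => hD n i
  refine ⟨L, φ, hφ, fun i => hL i trivial, fun i x => ?_⟩
  have := tendsto_pi_nhds.1 (tendsto_pi_nhds.1 hlim i) x
  rw [nhds_discrete, tendsto_pure] at this
  exact this

/-- Determinism in direction `u` is witnessed by a strip of bounded width. -/
theorem DeterministicIn.exists_strip {c : ℤ × ℤ → ℤ} (hfin : (Set.range c).Finite) {u : ℤ × ℤ}
    (hdet : DeterministicIn (orbitClosure c) u) :
    ∃ k : ℕ, ∀ d ∈ orbitClosure c, ∀ e ∈ orbitClosure c,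
      (∀ x, -(k : ℤ) ≤ inner2 x u → inner2 x u < 0 → d x = e x) →
        ∀ x, 0 ≤ inner2 x u → d x = e x := by
  have one_step : ∃ k : ℕ, ∀ d ∈ orbitClosure c, ∀ e ∈ orbitClosure c,
      (∀ x, -(k : ℤ) ≤ inner2 x u → inner2 x u < 0 → d x = e x) → d 0 = e 0 := by
    by_contra! hcon
    choose d hd e he heq hne using hcon
    obtain ⟨L, φ, hφ, hL, hlim⟩ := exists_limit hfin (fun n (b : Bool) => cond b (d n) (e n))
      (fun n b => by cases b <;> simp [hd, he])
    have hLeq : L true = L false := by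
      refine hdet _ (hL _) _ (hL _) fun x hx => ?_
      obtain ⟨n, h1, h2, h3⟩ := ((hlim true x).and ((hlim false x).and
        (eventually_ge_atTop (-inner2 x u).toNat))).exists
      have := hφ.id_le n
      rw [← h1, ← h2]
      exact heq _ x (by simp only [id] at this; omega) hx
    obtain ⟨n, h1, h2⟩ := ((hlim true 0).and (hlim false 0)).exists
    exact hne (φ n) (by simpa [hLeq] using h1.trans ((congrFun hLeq 0).trans h2.symm))
  obtain ⟨k, hk⟩ := one_step
  refine ⟨k, fun d hd e he heq => ?_⟩
  have main : ∀ m : ℕ, ∀ x, inner2 x u = m → d x = e x := by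
    intro m
    induction m using Nat.strong_induction_on with
    | _ m ih =>
      intro x hx
      have := hk _ (translate_mem_orbitClosure hd (-x)) _ (translate_mem_orbitClosure he (-x))
        (fun y hy1 hy2 => ?_)
      · simpa [Translate] using this
      · simp only [Translate, sub_neg_eq_add]
        have hyx := inner2_add y x u
        by_cases h : inner2 (y + x) u < 0
        · exact heq _ (by omega) h
        · exact ih (inner2 (y + x) u).toNat (by omega) _ (by omega)
  exact fun x hx => main (inner2 x u).toNat x (by omega)

theorem finite_box {u : ℤ × ℤ} (hu : u ≠ 0) (k l : ℤ) :
    {x : ℤ × ℤ | -k ≤ inner2 x u ∧ inner2 x u < 0 ∧ 0 ≤ inner2 x (perp u) ∧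
      inner2 x (perp u) < l}.Finite := by
  refine Set.Finite.of_finite_image (f := fun x => (inner2 x u, inner2 x (perp u)))
    (((Set.finite_Ico (-k) 0).prod (Set.finite_Ico 0 l)).subset ?_) ?_
  · rintro _ ⟨x, ⟨h1, h2, h3, h4⟩, rfl⟩
    exact ⟨⟨h1, h2⟩, ⟨h3, h4⟩⟩
  · intro x _ y _ h
    simp only [Prod.mk.injEq] at h
    obtain ⟨h1, h2⟩ := h
    have hpos := (inner2_self_pos hu).ne'
    simp only [inner2, perp] at h1 h2 hpos
    ext
    · refine mul_left_cancel₀ hpos ?_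
      linear_combination u.1 * h1 - u.2 * h2
    · refine mul_left_cancel₀ hpos ?_
      linear_combination u.2 * h1 + u.1 * h2

/-- For pairs of configurations whose difference is periodic in a direction orthogonal to `u`,
determinism in direction `u` is witnessed by a finite window. -/
theorem DeterministicIn.exists_window {c : ℤ × ℤ → ℤ} (hfin : (Set.range c).Finite) {u : ℤ × ℤ}
    (hu : u ≠ 0) (hdet : DeterministicIn (orbitClosure c) u) {N : ℕ} (hN : 0 < N) :
    ∃ W : Set (ℤ × ℤ), W.Finite ∧ ∀ d ∈ orbitClosure c, ∀ e ∈ orbitClosure c,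
      Function.Periodic (d - e) ((N : ℤ) • perp u) → ∀ t, (∀ x ∈ W, d (x + t) = e (x + t)) →
        ∀ x, inner2 t u ≤ inner2 x u → d x = e x := by
  obtain ⟨k, hk⟩ := hdet.exists_strip hfin
  refine ⟨_, finite_box hu k (N * inner2 u u), fun d hd e he hper t heq x hx => ?_⟩
  have hpos : 0 < N * inner2 u u := mul_pos (by exact_mod_cast hN) (inner2_self_pos hu)
  have := hk _ (translate_mem_orbitClosure hd (-t)) _ (translate_mem_orbitClosure he (-t))
    (fun y hy1 hy2 => ?_) (x - t) (by rw [inner2_sub]; omega)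
  · simpa [Translate] using this
  · simp only [Translate, sub_neg_eq_add]
    set q := inner2 y (perp u) / (N * inner2 u u) with hq
    set z := y - q • (N : ℤ) • perp u with hz
    have hzp : inner2 z (perp u) = inner2 y (perp u) % (N * inner2 u u) := by
      rw [hz, inner2_sub, inner2_smul, inner2_smul, inner2_perp_perp, Int.emod_def, ← hq]
      ring
    have hzu : inner2 z u = inner2 y u := by
      rw [hz, inner2_sub, inner2_smul, inner2_smul, inner2_perp_self]; ring
    have h1 := heq z ⟨by rwa [hzu], by rwa [hzu], hzp ▸ Int.emod_nonneg _ hpos.ne',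
      hzp ▸ Int.emod_lt_of_pos _ hpos⟩
    have h2 := hper.sub_zsmul_eq q (x := y + t)
    rw [show y + t - q • (N : ℤ) • perp u = z + t by rw [hz]; abel] at h2
    simp only [Pi.sub_apply, h1, sub_self] at h2
    linarith

/-- Families in `X` whose differences are `p`-periodic and whose members are pairwise
distinguished by every translate of the window `W`. -/
structure Separated (X : Set (ℤ × ℤ → ℤ)) (p : ℤ × ℤ) (W : Set (ℤ × ℤ)) {ι : Type*}
    (D : ι → ℤ × ℤ → ℤ) : Prop where
  mem : ∀ i, D i ∈ X
  periodic : ∀ i j, Function.Periodic (D i - D j) p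
  ne : ∀ i j, i ≠ j → ∀ t, ∃ x ∈ W, D i (x + t) ≠ D j (x + t)

theorem Function.Periodic.translate_sub {d e : ℤ × ℤ → ℤ} {p : ℤ × ℤ}
    (h : Function.Periodic (d - e) p) (t : ℤ × ℤ) :
    Function.Periodic (Translate t d - Translate t e) p := by
  intro x
  have := h (x - t)
  rw [show x - t + p = x + p - t by abel] at this
  exact this

/-- A pointwise limit of translates of families that become separated is separated. -/
theorem exists_separated_limit {ι : Type*} [Countable ι] {c : ℤ × ℤ → ℤ}
    (hfin : (Set.range c).Finite) {p : ℤ × ℤ} {W : Set (ℤ × ℤ)} (hW : W.Finite)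
    (D : ι → ℤ × ℤ → ℤ) (hD : ∀ i, D i ∈ orbitClosure c)
    (hper : ∀ i j, Function.Periodic (D i - D j) p) (s : ℕ → ℤ × ℤ)
    (hne : ∀ i j, i ≠ j → ∀ t, ∀ᶠ n in atTop, ∃ x ∈ W, D i (x + t - s n) ≠ D j (x + t - s n)) :
    ∃ L : ι → ℤ × ℤ → ℤ, ∃ φ : ℕ → ℕ, StrictMono φ ∧ Separated (orbitClosure c) p W L ∧
      ∀ i x, ∀ᶠ n in atTop, Translate (s (φ n)) (D i) x = L i x := by
  obtain ⟨L, φ, hφ, hL, hlim⟩ := exists_limit hfin (fun n i => Translate (s n) (D i))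
    (fun n i => translate_mem_orbitClosure (hD i) _)
  refine ⟨L, φ, hφ, ⟨hL, fun i j x => ?_, fun i j hij t => ?_⟩, hlim⟩
  · obtain ⟨n, h1, h2, h3, h4⟩ := ((hlim i x).and ((hlim j x).and
      ((hlim i (x + p)).and (hlim j (x + p))))).exists
    have := (hper i j).translate_sub (s (φ n)) x
    simpa only [Pi.sub_apply, h1, h2, h3, h4] using this
  · have hev : ∀ i, ∀ᶠ n in atTop, ∀ x ∈ W, Translate (s (φ n)) (D i) (x + t) = L i (x + t) :=
      fun i => (eventually_all_finite hW).2 fun x _ => hlim i (x + t)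
    obtain ⟨n, h1, h2, x, hx, hxne⟩ := ((hev i).and ((hev j).and
      (hφ.tendsto_atTop.eventually (hne i j hij t)))).exists
    refine ⟨x, hx, ?_⟩
    rw [← h1 x hx, ← h2 x hx]
    exact hxne

/-- There is a separated family of maximal size. -/
theorem exists_maximal_separated {c : ℤ × ℤ → ℤ} (hfin : (Set.range c).Finite) (p : ℤ × ℤ)
    {W : Set (ℤ × ℤ)} (hW : W.Finite) :
    ∃ Q : ℕ, (∃ D : Fin (Q + 1) → ℤ × ℤ → ℤ, Separated (orbitClosure c) p W D) ∧
      ¬ ∃ D : Fin (Q + 1 + 1) → ℤ × ℤ → ℤ, Separated (orbitClosure c) p W D := by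
  by_contra! hcon
  have hall : ∀ Q : ℕ, ∃ D : Fin (Q + 1) → ℤ × ℤ → ℤ, Separated (orbitClosure c) p W D := by
    intro Q
    induction Q with
    | zero =>
      exact ⟨fun _ => c, fun _ => self_mem_orbitClosure c, fun _ _ _ => by simp,
        fun i j hij => absurd (Subsingleton.elim (α := Fin 1) i j) hij⟩
    | succ Q ih => exact hcon Q ih
  have : Finite W := hW
  have : Finite (Set.range c) := hfin
  have := Fintype.ofFinite (W → Set.range c)
  obtain ⟨D, hD⟩ := hall (Fintype.card (W → Set.range c))
  have hinj : Function.Injective fun i (x : W) =>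
      (⟨D i x, mem_range_of_mem_orbitClosure (hD.mem i) x⟩ : Set.range c) := by
    intro i j h
    by_contra hij
    obtain ⟨x, hx, hne⟩ := hD.ne i j hij 0
    refine hne ?_
    simpa using congrArg Subtype.val (congrFun h ⟨x, hx⟩)
  have := Fintype.card_le_of_injective _ hinj
  simp at this

/-- If `c : ℤ² → ℤ` takes finitely many values and has a
non-trivial annihilator, and `u` is a one-sided direction of determinism of the
orbit closure of `c`, then the orbit closure of `c` contains a configuration `d`
whose orbit closure is deterministic in both directions `u` and `−u`. -/
theorem exists_two_sided_determinism
    (c : ℤ × ℤ → ℤ) (hfin : (Set.range c).Finite)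
    (f : (ℤ × ℤ) →₀ ℤ) (hf : f ≠ 0) (hann : Annihilates f c)
    (u : ℤ × ℤ) (hu : u ≠ 0)
    (hdetu : DeterministicIn (orbitClosure c) u)
    (hnotdet : ¬ DeterministicIn (orbitClosure c) (-u)) :
    ∃ d ∈ orbitClosure c,
      DeterministicIn (orbitClosure d) u ∧ DeterministicIn (orbitClosure d) (-u) := by
  obtain ⟨M, hM⟩ : ∃ M : ℤ, ∀ x, |c x| ≤ M := by
    obtain ⟨M, hM⟩ := (hfin.image abs).bddAbove
    exact ⟨M, fun x => hM ⟨c x, ⟨x, rfl⟩, rfl⟩⟩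
  have hbound : ∀ d ∈ orbitClosure c, ∀ x, |d x| ≤ M := by
    intro d hd x
    obtain ⟨y, hy⟩ := mem_range_of_mem_orbitClosure hd x
    exact hy ▸ hM y
  obtain ⟨N, hN, hper⟩ := exists_common_period hf hu (2 * M)
  set p := (N : ℤ) • perp u
  have hagree : ∀ d ∈ orbitClosure c, ∀ e ∈ orbitClosure c,
      (∀ x, 0 < inner2 x u → d x = e x) → Function.Periodic (d - e) p := by
    intro d hd e he heq
    refine hper (d - e) (fun x => ?_) (fun n => ?_) (fun x hx => sub_eq_zero.2 (heq x hx))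
    · have := abs_sub (d x) (e x)
      have := hbound d hd x
      have := hbound e he x
      simp only [Pi.sub_apply]
      linarith
    · simp only [Pi.sub_apply, mul_sub, Finset.sum_sub_distrib]
      rw [annihilates_of_mem_orbitClosure hann hd n, annihilates_of_mem_orbitClosure hann he n,
        sub_zero]
  obtain ⟨W, hW, hwin⟩ := hdetu.exists_window hfin hu hN
  obtain ⟨Q, ⟨D, hD⟩, hmax⟩ := exists_maximal_separated hfin p hW
  have hsub := orbitClosure_subset (hD.mem 0)
  refine ⟨D 0, hD.mem 0, fun d hd e he => hdetu d (hsub hd) e (hsub he), fun d hd e he heq => ?_⟩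
  have heq : ∀ x, 0 < inner2 x u → d x = e x := fun x hx => heq (by
    simp only [halfPlane, inner2, Set.mem_ofPred_eq, Prod.fst_neg, Prod.snd_neg] at hx ⊢
    linarith)
  obtain ⟨E, hE, rfl⟩ : ∃ E : Fin (Q + 1) → ℤ × ℤ → ℤ,
      Separated (orbitClosure c) p W E ∧ E 0 = d := by
    obtain ⟨y, hy, hlim⟩ := mem_closure_iff_seq_limit.1 hd
    choose s hs using hy
    obtain ⟨E, φ, hφ, hE, hElim⟩ := exists_separated_limit hfin hW D hD.mem hD.periodic s
      fun i j hij t => Eventually.of_forall fun n => by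
        obtain ⟨x, hx, hne⟩ := hD.ne i j hij (t - s n)
        exact ⟨x, hx, by rwa [add_sub_assoc]⟩
    refine ⟨E, hE, funext fun x => ?_⟩
    have h := tendsto_pi_nhds.1 hlim x
    rw [nhds_discrete, tendsto_pure] at h
    obtain ⟨n, h1, h2⟩ := ((hElim 0 x).and (hφ.tendsto_atTop.eventually h)).exists
    rw [← h1, ← h2, hs]
  by_contra hne
  obtain ⟨x₀, hx₀⟩ : ∃ x, E 0 x ≠ e x := Function.ne_iff.1 hne
  have hupos := inner2_self_pos hu
  have he' := hsub he
  have hEe : ∀ i, Function.Periodic (E i - e) p := by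
    intro i
    have := (hE.periodic i 0).add (hagree _ (hE.mem 0) e he' heq)
    rwa [sub_add_sub_cancel] at this
  have hsep : ∀ i t, inner2 t u ≤ inner2 x₀ u → ∃ x ∈ W, E i (x + t) ≠ e (x + t) := by
    intro i t ht
    by_contra! hW'
    have habove := hwin _ (hE.mem i) e he' (hEe i) t hW'
    by_cases hi : i = 0
    · exact hx₀ (hi ▸ habove x₀ ht)
    obtain ⟨B, hB⟩ := (hW.image fun x => -inner2 x u).bddAbove
    let m : ℤ := |B| + |inner2 t u| + 1
    obtain ⟨x, hx, hxne⟩ := hE.ne i 0 hi (m • u)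
    have hxB : -inner2 x u ≤ B := hB ⟨x, hx, rfl⟩
    have hlevel : |inner2 t u| + 1 ≤ inner2 (x + m • u) u := by
      rw [inner2_add, inner2_smul]
      have := le_abs_self B
      have hm : 0 ≤ m := by positivity
      have : m ≤ m * inner2 u u := le_mul_of_one_le_right hm hupos
      simp only [m] at this ⊢
      linarith
    refine hxne ?_
    rw [habove _ (by have := le_abs_self (inner2 t u); linarith),
      heq _ (by have := abs_nonneg (inner2 t u); linarith)]
  have hlow : ∀ i t, ∀ᶠ n : ℕ in atTop,
      ∃ x ∈ W, E i (x + t - (n : ℤ) • u) ≠ e (x + t - (n : ℤ) • u) := by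
    intro i t
    filter_upwards [eventually_ge_atTop (inner2 t u - inner2 x₀ u).toNat] with n hn
    obtain ⟨x, hx, h⟩ := hsep i (t - (n : ℤ) • u) (by
      rw [inner2_sub, inner2_smul]
      have : (n : ℤ) ≤ n * inner2 u u := le_mul_of_one_le_right (by positivity) hupos
      omega)
    exact ⟨x, hx, by rwa [add_sub_assoc]⟩
  obtain ⟨L, -, -, hL, -⟩ := exists_separated_limit hfin hW
    (Fin.cons e E : Fin (Q + 1 + 1) → ℤ × ℤ → ℤ) (p := p)
    (by
      intro i
      cases i using Fin.cases with
      | zero => exact he'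
      | succ i => exact hE.mem i)
    (by
      intro i j
      cases i using Fin.cases with
      | zero =>
        cases j using Fin.cases with
        | zero => intro x; simp
        | succ j =>
          intro x
          have := hEe j x
          simp only [Pi.sub_apply, Fin.cons_zero, Fin.cons_succ] at this ⊢
          linarith
      | succ i =>
        cases j using Fin.cases with
        | zero => exact hEe i
        | succ j => exact hE.periodic i j)
    (fun n => (n : ℤ) • u)
    (by
      intro i j hij t
      cases i using Fin.cases with
      | zero =>
        cases j using Fin.cases with
        | zero => exact absurd rfl hij
        | succ j => simpa only [Fin.cons_zero, Fin.cons_succ, ne_comm] using hlow j t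
      | succ i =>
        cases j using Fin.cases with
        | zero => simpa only [Fin.cons_zero, Fin.cons_succ] using hlow i t
        | succ j =>
          refine Eventually.of_forall fun n => ?_
          obtain ⟨x, hx, h⟩ := hE.ne i j (fun h => hij (h ▸ rfl)) (t - (n : ℤ) • u)
          exact ⟨x, hx, by simpa only [Fin.cons_succ, add_sub_assoc] using h⟩)
  exact hmax ⟨L, hL⟩
end
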